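/- arXiv:0905.0830 — 2 statements merged into one kernel-verified Lean document; each statement's English description precedes it below -/
import Mathlib

section
/- If α is badly approximable, then there exists a constant C₁(α) > 0 such that for all positive integers m, the sum over x from 1 to m of 1/(‖αx‖·x) is at most C₁(α)·(log m)² (for m ≥ 2). -/
noncomputable def nint (y : ℝ) : ℝ := |y - round y|

theorem nint_le_aux (y : ℝ) (z : ℤ) : nint y ≤ |y - z| := round_le y z

theorem nint_sep (a b : ℝ) :
    nint (b - a) ≤ |nint a - nint b| ∨ nint (b + a) ≤ |nint a - nint b| := by
  have h1 := nint_le_aux (b - a) (round b - round a)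
  have h2 := nint_le_aux (b + a) (round b + round a)
  push_cast at h1 h2
  have e1 : b - a - ((round b : ℝ) - round a) = (b - round b) - (a - round a) := by ring
  have e2 : b + a - ((round b : ℝ) + round a) = (b - round b) + (a - round a) := by ring
  rw [e1] at h1
  rw [e2] at h2
  have ha : nint a = |a - round a| := rfl
  have hb : nint b = |b - round b| := rfl
  rw [ha, hb]
  generalize a - (round a : ℝ) = u at *
  generalize b - (round b : ℝ) = v at *
  rcases abs_cases u with ⟨hu, _⟩ | ⟨hu, _⟩ <;> rcases abs_cases v with ⟨hv, _⟩ | ⟨hv, _⟩ <;>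
    rw [hu, hv]
  · left; rw [abs_sub_comm]; exact h1
  · right; convert h2 using 2; ring
  · right; rw [← abs_neg]; convert h2 using 2; ring
  · left; convert h1 using 2; ring

theorem block_bound (α δ : ℝ) (hδ : 0 < δ)
    (h : ∀ q : ℕ, 1 ≤ q → δ ≤ (q : ℝ) * nint (q * α)) (N : ℕ) :
    ∑ x ∈ Finset.Icc 1 N, 1 / nint (α * x) ≤ (2 * N / δ) * (harmonic ⌊(N : ℝ) / δ⌋₊ : ℝ) := by
  rcases Nat.eq_zero_or_pos N with rfl | hN
  · simp
  have hN' : (0 : ℝ) < N := by exact_mod_cast hN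
  set f : ℕ → ℕ := fun x => ⌊nint (α * x) * (2 * N / δ)⌋₊ with hf
  have hc : 0 < 2 * N / δ := by positivity
  have key : ∀ q : ℕ, 1 ≤ q → q ≤ 2 * N → 1 ≤ nint (q * α) * (2 * N / δ) := by
    intro q hq hq2
    have h1 := h q hq
    have h2 : (q : ℝ) ≤ 2 * N := by exact_mod_cast hq2
    have h3 : 0 ≤ nint (q * α) := abs_nonneg _
    rw [← mul_div_assoc, le_div_iff₀ hδ]
    nlinarith
  have hone : ∀ x ∈ Finset.Icc 1 N, 1 ≤ f x := by
    intro x hx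
    rw [Finset.mem_Icc] at hx
    apply Nat.le_floor
    have := key x hx.1 (by omega)
    rw [mul_comm α]
    simpa using this
  have hle : ∀ x ∈ Finset.Icc 1 N, f x ≤ ⌊(N : ℝ) / δ⌋₊ := by
    intro x hx
    apply Nat.floor_le_floor
    have h1 : nint (α * x) ≤ 1 / 2 := abs_sub_round _
    calc nint (α * x) * (2 * N / δ) ≤ 1 / 2 * (2 * N / δ) := by gcongr
      _ = N / δ := by ring
  have hlt : ∀ x ∈ Finset.Icc 1 N, ∀ y ∈ Finset.Icc 1 N, x < y → f x ≠ f y := by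
    intro x hx y hy hxy hxy2
    rw [Finset.mem_Icc] at hx hy
    have p1 : 0 ≤ nint (α * x) * (2 * N / δ) := mul_nonneg (abs_nonneg _) hc.le
    have p2 : 0 ≤ nint (α * y) * (2 * N / δ) := mul_nonneg (abs_nonneg _) hc.le
    have a1 := Nat.floor_le p1
    have a2 := Nat.floor_le p2
    have b1 := Nat.lt_floor_add_one (nint (α * x) * (2 * N / δ))
    have b2 := Nat.lt_floor_add_one (nint (α * y) * (2 * N / δ))
    have e : (⌊nint (α * x) * (2 * N / δ)⌋₊ : ℝ) = ⌊nint (α * y) * (2 * N / δ)⌋₊ := by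
      exact congrArg (fun k : ℕ => (k : ℝ)) hxy2
    have hd : |nint (α * x) - nint (α * y)| * (2 * N / δ) < 1 := by
      rw [← abs_of_pos hc, ← abs_mul, abs_lt]
      constructor <;> rw [sub_mul] <;> linarith
    rcases nint_sep (α * x) (α * y) with h1 | h1
    · have := key (y - x) (by omega) (by omega)
      rw [Nat.cast_sub hxy.le, show ((y : ℝ) - x) * α = α * y - α * x by ring] at this
      have := mul_le_mul_of_nonneg_right h1 hc.le
      linarith
    · have := key (y + x) (by omega) (by omega)
      rw [Nat.cast_add, show ((y : ℝ) + x) * α = α * y + α * x by ring] at this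
      have := mul_le_mul_of_nonneg_right h1 hc.le
      linarith
  have hinj : Set.InjOn f (Finset.Icc 1 N : Finset ℕ) := by
    intro x hx y hy hxy
    by_contra hne
    rcases lt_or_gt_of_ne hne with h1 | h1
    · exact hlt x hx y hy h1 hxy
    · exact hlt y hy x hx h1 hxy.symm
  have hterm : ∀ x ∈ Finset.Icc 1 N,
      1 / nint (α * x) ≤ (2 * N / δ) * ((f x : ℝ))⁻¹ := by
    intro x hx
    have h1 : (1 : ℝ) ≤ f x := by exact_mod_cast hone x hx
    have h2 : (f x : ℝ) ≤ nint (α * x) * (2 * N / δ) :=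
      Nat.floor_le (mul_nonneg (abs_nonneg _) hc.le)
    have h3 : 0 < nint (α * x) := by
      by_contra hcon
      have : nint (α * x) * (2 * N / δ) ≤ 0 :=
        mul_nonpos_of_nonpos_of_nonneg (not_lt.mp hcon) hc.le
      linarith
    rw [← div_eq_mul_inv, div_le_div_iff₀ h3 (by linarith)]
    linarith
  calc ∑ x ∈ Finset.Icc 1 N, 1 / nint (α * x)
      ≤ ∑ x ∈ Finset.Icc 1 N, (2 * N / δ) * ((f x : ℝ))⁻¹ := Finset.sum_le_sum hterm
    _ = (2 * N / δ) * ∑ k ∈ (Finset.Icc 1 N).image f, ((k : ℝ))⁻¹ := by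
        rw [← Finset.mul_sum, Finset.sum_image hinj]
    _ ≤ (2 * N / δ) * (harmonic ⌊(N : ℝ) / δ⌋₊ : ℝ) := by
        apply mul_le_mul_of_nonneg_left _ hc.le
        rw [harmonic_eq_sum_Icc]
        push_cast
        apply Finset.sum_le_sum_of_subset_of_nonneg
        · intro k hk
          rw [Finset.mem_image] at hk
          obtain ⟨x, hx, rfl⟩ := hk
          exact Finset.mem_Icc.mpr ⟨hone x hx, hle x hx⟩
        · intros; positivity

theorem abel_aux (a : ℕ → ℝ) (B : ℝ) (m : ℕ) (hB : 0 ≤ B)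
    (h : ∀ n ≤ m, ∑ x ∈ Finset.Icc 1 n, a x ≤ B * n) (n : ℕ) (hn : n ≤ m) :
    ∑ x ∈ Finset.Icc 1 n, a x / x ≤ (∑ x ∈ Finset.Icc 1 n, a x) / n + B * (harmonic n : ℝ) := by
  induction n with
  | zero => simp
  | succ n ih =>
    have ih := ih (by omega)
    rw [Finset.sum_Icc_succ_top (by omega), Finset.sum_Icc_succ_top (by omega), harmonic_succ]
    have hS := h n (by omega)
    push_cast
    generalize (∑ x ∈ Finset.Icc 1 n, a x / x) = T at *
    rcases Nat.eq_zero_or_pos n with rfl | hp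
    · simp at *
      linarith
    generalize (∑ x ∈ Finset.Icc 1 n, a x) = S at *
    have hp' : (0 : ℝ) < n := by exact_mod_cast hp
    have h1 : S / n - S / (n + 1) ≤ B * ((n : ℝ) + 1)⁻¹ := by
      rw [show S / n - S / (n + 1) = (S / n) * ((n : ℝ) + 1)⁻¹ by field_simp; ring]
      apply mul_le_mul_of_nonneg_right _ (by positivity)
      rwa [div_le_iff₀ hp']
    rw [add_div]
    linarith

theorem stmt_1 (α : ℝ) (hα : ∃ δ > 0, ∀ q : ℕ, 1 ≤ q → δ ≤ (q : ℝ) * nint (q * α)) :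
    ∃ C > 0, ∀ m : ℕ, 2 ≤ m →
      ∑ x ∈ Finset.Icc 1 m, 1 / (nint (α * x) * x) ≤ C * (Real.log m) ^ 2 := by
  obtain ⟨δ, hδ, h⟩ := hα
  have hδ1 : δ ≤ 1 / 2 := by
    have h1 := h 1 le_rfl
    have h2 : nint ((1 : ℕ) * α) ≤ 1 / 2 := abs_sub_round _
    rw [Nat.cast_one] at *
    linarith
  have hL : 0 ≤ Real.log (1 / δ) := Real.log_nonneg (by rw [le_div_iff₀ hδ]; linarith)
  refine ⟨2 / δ * (3 + 2 * Real.log (1 / δ)) * 5, by positivity, ?_⟩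
  intro m hm
  have hm' : (2 : ℝ) ≤ m := by exact_mod_cast hm
  have hlog : 1 / 2 ≤ Real.log m := by
    have := Real.log_le_log (by norm_num) hm'
    have := Real.log_two_gt_d9
    linarith
  set l := Real.log m with hl
  set L := Real.log (1 / δ) with hLdef
  have hharm : ∀ n ≤ m, (harmonic ⌊(n : ℝ) / δ⌋₊ : ℝ) ≤ (3 + 2 * L) * l := by
    intro n hn
    rcases Nat.eq_zero_or_pos n with rfl | hp
    · simp; positivity
    have hn1 : (1 : ℝ) ≤ n := by exact_mod_cast hp
    have hnm : (n : ℝ) ≤ m := by exact_mod_cast hn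
    have h1 := harmonic_floor_le_one_add_log ((n : ℝ) / δ) (by rw [le_div_iff₀ hδ]; linarith)
    have h2 : Real.log ((n : ℝ) / δ) = Real.log n + L := by
      rw [hLdef, ← Real.log_mul (by positivity) (by positivity)]
      congr 1; ring
    have h3 : Real.log n ≤ l := Real.log_le_log (by linarith) hnm
    nlinarith
  set B := 2 / δ * ((3 + 2 * L) * l) with hB
  have hB0 : 0 ≤ B := by positivity
  have hS : ∀ n ≤ m, ∑ x ∈ Finset.Icc 1 n, 1 / nint (α * x) ≤ B * n := by
    intro n hn
    refine (block_bound α δ hδ h n).trans ?_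
    calc _ ≤ (2 * n / δ) * ((3 + 2 * L) * l) :=
          mul_le_mul_of_nonneg_left (hharm n hn) (by positivity)
      _ = B * n := by rw [hB]; ring
  have hT := abel_aux (fun x => 1 / nint (α * x)) B m hB0 hS m le_rfl
  have hSm : (∑ x ∈ Finset.Icc 1 m, 1 / nint (α * x)) / m ≤ B := by
    rw [div_le_iff₀ (by linarith)]
    exact hS m le_rfl
  have hH : (harmonic m : ℝ) ≤ 1 + l := harmonic_le_one_add_log m
  have hfin : B * (harmonic m : ℝ) ≤ B * (1 + l) := mul_le_mul_of_nonneg_left hH hB0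
  simp only [div_div] at hT
  simp only [one_div] at hT hSm ⊢
  calc _ ≤ B + B * (1 + l) := by linarith
    _ = B * (2 + l) := by ring
    _ ≤ B * (5 * l) := mul_le_mul_of_nonneg_left (by linarith) hB0
    _ = _ := by rw [hB]; ring
end

section
/- For every badly approximable real number α, the set of real numbers β such that liminf_{q→∞} q·(log q)²·‖qα‖·‖qβ‖ > 0 has full Hausdorff dimension (dimension 1). -/
open Filter

theorem nint_le (y : ℝ) (m : ℤ) : nint y ≤ |y - m| := round_le y m
theorem nint_nonneg (y : ℝ) : 0 ≤ nint y := abs_nonneg _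
theorem nint_le_half (y : ℝ) : nint y ≤ 1 / 2 := abs_sub_round y

theorem nint_eq_of_lt {y : ℝ} {m : ℤ} (h : |y - m| < 1 / 2) : nint y = |y - m| := by
  have h1 := nint_le_half y
  unfold nint at *
  have h2 : |((round y : ℤ) : ℝ) - m| < 1 := by
    calc |((round y : ℤ) : ℝ) - m| = |(y - m) - (y - round y)| := by congr 1; ring
      _ ≤ |y - m| + |y - round y| := abs_sub _ _
      _ < 1 := by linarith
  have h3 : round y = m := by
    have : |round y - m| < 1 := by exact_mod_cast h2
    have := Int.abs_lt_one_iff.mp this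
    omega
  rw [h3]

theorem nint_lip (x y : ℝ) : nint x ≤ nint y + |x - y| := by
  calc nint x ≤ |x - round y| := nint_le _ _
    _ = |(y - round y) + (x - y)| := by congr 1; ring
    _ ≤ _ := abs_add_le _ _

theorem nint_neg (x : ℝ) : nint (-x) = nint x := by
  have key : ∀ x : ℝ, nint (-x) ≤ nint x := by
    intro x
    have := nint_le (-x) (-(round x))
    have e : |-x - ((-(round x) : ℤ) : ℝ)| = nint x := by
      rw [← abs_neg]; unfold nint; congr 1; push_cast; ring
    rwa [e] at this
  apply le_antisymm (key x)
  have := key (-x)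
  simpa using this

/-- distance lower bound for nonzero integer multiples -/
theorem nint_int_ge {α δ : ℝ} (hα : ∀ q : ℕ, 1 ≤ q → δ ≤ (q : ℝ) * nint (q * α))
    (t : ℤ) (ht : t ≠ 0) : δ ≤ |(t : ℝ)| * nint (t * α) := by
  have h1 : 1 ≤ t.natAbs := Int.natAbs_pos.mpr ht
  have h := hα t.natAbs h1
  have e1 : ((t.natAbs : ℕ) : ℝ) = |(t : ℝ)| := by
    rw [← Int.cast_natCast, Int.natCast_natAbs, Int.cast_abs]
  rw [e1] at h
  rcases abs_choice (t : ℝ) with h2 | h2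
  · rw [h2] at h ⊢; exact h
  · rw [h2] at h ⊢
    rwa [neg_mul (t:ℝ) α, nint_neg] at h

theorem card_divisors_pow_four (n : ℕ) (hn : n ≠ 0) :
    (n.divisors.card) ^ 4 ≤ 256 ^ 16 * n := by
  have key : ∀ p a : ℕ, p.Prime → (a + 1) ^ 4 ≤ (if p < 16 then 256 else 1) * p ^ a := by
    intro p a hp
    split_ifs with h
    · have h2 : (a + 1) ^ 4 ≤ 256 * 2 ^ a := by
        rcases lt_or_ge a 8 with h8 | h8
        · interval_cases a <;> norm_num
        · induction a, h8 using Nat.le_induction with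
          | base => norm_num
          | succ a ha ih =>
            have : (a + 1 + 1) ^ 4 ≤ 2 * (a + 1) ^ 4 := by
              obtain ⟨k, rfl⟩ := Nat.exists_eq_add_of_le ha
              ring_nf
              nlinarith [sq_nonneg (k:ℤ), Nat.zero_le k, Nat.zero_le (k^2), Nat.zero_le (k^3), Nat.zero_le (k^4)]
            calc _ ≤ 2 * (a + 1) ^ 4 := this
              _ ≤ 2 * (256 * 2 ^ a) := by omega
              _ = _ := by ring
      calc _ ≤ _ := h2
        _ ≤ 256 * p ^ a := Nat.mul_le_mul_left _ (Nat.pow_le_pow_left hp.two_le a)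
    · have h1 : a + 1 ≤ 2 ^ a := Nat.lt_two_pow_self
      calc (a + 1) ^ 4 ≤ (2 ^ a) ^ 4 := Nat.pow_le_pow_left h1 4
        _ = 16 ^ a := by rw [← pow_mul, mul_comm, pow_mul]; norm_num
        _ ≤ p ^ a := Nat.pow_le_pow_left (by omega) a
        _ = 1 * p ^ a := by ring
  rw [Nat.card_divisors hn, ← Finset.prod_pow]
  calc ∏ x ∈ n.primeFactors, (n.factorization x + 1) ^ 4
      ≤ ∏ x ∈ n.primeFactors, ((if x < 16 then 256 else 1) * x ^ (n.factorization x)) :=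
        Finset.prod_le_prod' (fun x hx => key x _ (Nat.prime_of_mem_primeFactors hx))
    _ = (∏ x ∈ n.primeFactors, (if x < 16 then 256 else 1)) * n := by
        rw [Finset.prod_mul_distrib]; congr 1
        exact Nat.prod_factorization_pow_eq_self hn
    _ ≤ 256 ^ 16 * n := by
        apply Nat.mul_le_mul_right
        rw [← Finset.prod_filter, Finset.prod_const]
        apply Nat.pow_le_pow_right (by norm_num)
        calc _ ≤ (Finset.range 16).card := Finset.card_le_card (by
              intro x hx; simp at hx ⊢; exact hx.2)
          _ = 16 := by simp

theorem sum_inv_int (X : ℕ) :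
    ∑ j ∈ Finset.Icc (-(X : ℤ)) X, 1 / (|(j : ℝ)| + 1) ≤ 2 * (1 + Real.log (X + 1)) := by
  have hsub : Finset.Icc (-(X : ℤ)) X ⊆
      (Finset.range (X + 1)).image (fun i : ℕ => (i : ℤ)) ∪
      (Finset.range (X + 1)).image (fun i : ℕ => -(i : ℤ)) := by
    intro j hj
    simp only [Finset.mem_Icc] at hj
    simp only [Finset.mem_union, Finset.mem_image, Finset.mem_range]
    rcases le_total 0 j with h | h
    · left; exact ⟨j.toNat, by omega, by omega⟩
    · right; exact ⟨(-j).toNat, by omega, by omega⟩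
  have hH : ∑ i ∈ Finset.range (X + 1), 1 / ((i : ℝ) + 1) ≤ 1 + Real.log (X + 1) := by
    have := harmonic_le_one_add_log (X + 1)
    unfold harmonic at this
    push_cast at this
    simpa using this
  calc _ ≤ ∑ j ∈ ((Finset.range (X + 1)).image (fun i : ℕ => (i : ℤ)) ∪
      (Finset.range (X + 1)).image (fun i : ℕ => -(i : ℤ))), 1 / (|(j : ℝ)| + 1) :=
        Finset.sum_le_sum_of_subset_of_nonneg hsub (fun _ _ _ => by positivity)
    _ ≤ ∑ j ∈ (Finset.range (X + 1)).image (fun i : ℕ => (i : ℤ)), 1 / (|(j : ℝ)| + 1)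
        + ∑ j ∈ (Finset.range (X + 1)).image (fun i : ℕ => -(i : ℤ)), 1 / (|(j : ℝ)| + 1) := by
        rw [← Finset.sum_union_inter]
        have : 0 ≤ ∑ j ∈ ((Finset.range (X + 1)).image (fun i : ℕ => (i : ℤ)) ∩
          (Finset.range (X + 1)).image (fun i : ℕ => -(i : ℤ))), 1 / (|(j : ℝ)| + 1) :=
          Finset.sum_nonneg (fun _ _ => by positivity)
        linarith
    _ = ∑ i ∈ Finset.range (X + 1), 1 / ((i : ℝ) + 1)
        + ∑ i ∈ Finset.range (X + 1), 1 / ((i : ℝ) + 1) := by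
        rw [Finset.sum_image (by intro a _ b _ h; simpa using h),
          Finset.sum_image (by intro a _ b _ h; simpa using h)]
        simp
    _ ≤ _ := by linarith

theorem block_sum {α δ : ℝ} (hδ : 0 < δ)
    (hα : ∀ q : ℕ, 1 ≤ q → δ ≤ (q : ℝ) * nint (q * α)) :
    ∃ C : ℝ, 0 < C ∧ ∀ n : ℕ, 1 ≤ n →
      ∑ q ∈ Finset.Ico ((2:ℕ) ^ n) (2 ^ (n + 1)), 1 / ((q : ℝ) * nint (q * α)) ≤ C * n := by
  obtain ⟨E, hE⟩ := pow_unbounded_of_one_lt (1 / δ) (by norm_num : (1 : ℝ) < 2)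
  refine ⟨(4 / δ) * (2 * (E + 3)), by positivity, ?_⟩
  intro n hn
  set y : ℕ → ℝ := fun q => (q : ℝ) * α - round ((q : ℝ) * α) with hy
  set f : ℕ → ℤ := fun q => ⌊y q * (2 ^ n / δ)⌋ with hf
  have hyn : ∀ q, |y q| = nint (q * α) := fun q => rfl
  have h2n : (0 : ℝ) < 2 ^ n := by positivity
  have hinj : Set.InjOn f (Finset.Ico ((2:ℕ) ^ n) (2 ^ (n + 1)) : Finset ℕ) := by
    intro a ha b hb hab
    by_contra hne
    simp only [Finset.coe_Ico, Set.mem_Ico] at ha hb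
    have hd := Int.abs_sub_lt_one_of_floor_eq_floor hab
    rw [← sub_mul, abs_mul, abs_of_pos (by positivity : 0 < 2 ^ n / δ)] at hd
    have ht : ((a : ℤ) - b) ≠ 0 := by omega
    have h1 := nint_int_ge hα ((a : ℤ) - b) ht
    have h2 : nint ((((a : ℤ) - b : ℤ) : ℝ) * α) ≤ |y a - y b| := by
      have := nint_le ((((a : ℤ) - b : ℤ) : ℝ) * α) (round ((a : ℝ) * α) - round ((b : ℝ) * α))
      refine this.trans (le_of_eq ?_)
      congr 1
      simp only [hy]
      push_cast; ring
    have h3 : |(((a : ℤ) - b : ℤ) : ℝ)| ≤ 2 ^ n := by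
      have : |((a : ℤ) - b)| ≤ 2 ^ n := by
        rw [abs_le]
        have e : (2 : ℕ) ^ (n + 1) = 2 ^ n + 2 ^ n := by ring
        rw [e] at ha hb
        constructor <;> push_cast <;> zify at ha hb <;> linarith
      exact_mod_cast this
    have h4 : δ ≤ 2 ^ n * |y a - y b| :=
      h1.trans (mul_le_mul h3 h2 (nint_nonneg _) h2n.le)
    have h5 : 1 ≤ |y a - y b| * (2 ^ n / δ) := by
      rw [← mul_div_assoc, le_div_iff₀ hδ]; linarith
    linarith
  have hrange : ∀ q ∈ Finset.Ico ((2:ℕ) ^ n) (2 ^ (n + 1)),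
      f q ∈ Finset.Icc (-((2 ^ (n + E) : ℕ) : ℤ)) ((2 ^ (n + E) : ℕ) : ℤ) := by
    intro q _
    have h1 : |y q| ≤ 1 / 2 := nint_le_half _
    rw [abs_le] at h1
    have hX : 2 ^ n / δ ≤ 2 ^ (n + E) := by
      rw [pow_add, div_eq_mul_one_div]
      exact mul_le_mul_of_nonneg_left hE.le h2n.le
    have hpos : 0 < 2 ^ n / δ := by positivity
    rw [Finset.mem_Icc]
    constructor
    · rw [Int.le_floor]; push_cast; nlinarith
    · have : f q ≤ y q * (2 ^ n / δ) := Int.floor_le _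
      have h2 : (f q : ℝ) ≤ 2 ^ (n + E) := by nlinarith
      have h3 : (f q : ℝ) ≤ (((2 ^ (n + E) : ℕ) : ℤ) : ℝ) := by push_cast; exact h2
      exact_mod_cast h3
  have hterm : ∀ q ∈ Finset.Ico ((2:ℕ) ^ n) (2 ^ (n + 1)),
      1 / ((q : ℝ) * nint (q * α)) ≤ (4 / δ) * (1 / (|(f q : ℝ)| + 1)) := by
    intro q hq
    rw [Finset.mem_Ico] at hq
    have hq1 : 1 ≤ q := le_trans Nat.one_le_two_pow hq.1
    have hqr : (2 : ℝ) ^ n ≤ q := by exact_mod_cast hq.1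
    have h1 := hα q hq1
    have h2 : (f q : ℝ) ≤ y q * (2 ^ n / δ) := Int.floor_le _
    have h3 : y q * (2 ^ n / δ) < f q + 1 := Int.lt_floor_add_one _
    have h4 : |(f q : ℝ)| ≤ |y q| * (2 ^ n / δ) + 1 := by
      have hpos : 0 < 2 ^ n / δ := by positivity
      have : |y q * (2 ^ n / δ)| = |y q| * (2 ^ n / δ) := by rw [abs_mul, abs_of_pos hpos]
      rw [← this, abs_le]
      constructor
      · have := neg_abs_le (y q * (2 ^ n / δ)); linarith
      · have := le_abs_self (y q * (2 ^ n / δ)); linarith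
    rw [← hyn] at h1 ⊢
    set Y := (q : ℝ) * |y q| with hY
    have h5 : |y q| * (2 ^ n / δ) ≤ Y / δ := by
      rw [← mul_div_assoc]; apply div_le_div_of_nonneg_right _ hδ.le
      rw [hY, mul_comm]; exact mul_le_mul_of_nonneg_right hqr (abs_nonneg _)
    have hYpos : 0 < Y := lt_of_lt_of_le hδ h1
    have h6 : 1 ≤ Y / δ := by rw [le_div_iff₀ hδ]; linarith
    rw [div_mul_div_comm, mul_one, div_le_div_iff₀ hYpos (by positivity)]
    have h7 : |(f q : ℝ)| + 1 ≤ 4 * (Y / δ) := by linarith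
    have h8 : δ * (|(f q : ℝ)| + 1) ≤ δ * (4 * (Y / δ)) := mul_le_mul_of_nonneg_left h7 hδ.le
    have h9 : δ * (4 * (Y / δ)) = 4 * Y := by field_simp
    linarith
  calc _ ≤ ∑ q ∈ Finset.Ico ((2:ℕ) ^ n) (2 ^ (n + 1)), (4 / δ) * (1 / (|(f q : ℝ)| + 1)) :=
        Finset.sum_le_sum hterm
    _ = (4 / δ) * ∑ q ∈ Finset.Ico ((2:ℕ) ^ n) (2 ^ (n + 1)), (1 / (|(f q : ℝ)| + 1)) := by
        rw [Finset.mul_sum]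
    _ = (4 / δ) * ∑ j ∈ (Finset.Ico ((2:ℕ) ^ n) (2 ^ (n + 1))).image f, (1 / (|(j : ℝ)| + 1)) := by
        rw [Finset.sum_image hinj]
    _ ≤ (4 / δ) * ∑ j ∈ Finset.Icc (-((2 ^ (n + E) : ℕ) : ℤ)) ((2 ^ (n + E) : ℕ) : ℤ),
          (1 / (|(j : ℝ)| + 1)) := by
        apply mul_le_mul_of_nonneg_left _ (by positivity)
        apply Finset.sum_le_sum_of_subset_of_nonneg
        · intro j hj
          rw [Finset.mem_image] at hj
          obtain ⟨q, hq, rfl⟩ := hj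
          exact hrange q hq
        · intros; positivity
    _ ≤ (4 / δ) * (2 * (1 + Real.log ((2 ^ (n + E) : ℕ) + 1))) :=
        mul_le_mul_of_nonneg_left (sum_inv_int _) (by positivity)
    _ ≤ (4 / δ) * (2 * (E + 3)) * n := by
        rw [mul_assoc (4 / δ)]
        apply mul_le_mul_of_nonneg_left _ (by positivity)
        have h1 : Real.log (((2 ^ (n + E) : ℕ) : ℝ) + 1) ≤ n + E + 1 := by
          calc Real.log (((2 ^ (n + E) : ℕ) : ℝ) + 1) ≤ Real.log (2 ^ (n + E + 1)) := by
                apply Real.log_le_log (by positivity)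
                push_cast
                have : (1 : ℝ) ≤ 2 ^ (n + E) := one_le_pow₀ (by norm_num)
                rw [pow_succ]; linarith
            _ = (n + E + 1) * Real.log 2 := by rw [Real.log_pow]; push_cast; ring
            _ ≤ (n + E + 1) * 1 := by
                apply mul_le_mul_of_nonneg_left _ (by positivity)
                linarith [Real.log_two_lt_d9]
            _ = _ := by ring
        have hn' : (1 : ℝ) ≤ n := by exact_mod_cast hn
        have hE0 : (0 : ℝ) ≤ E := by positivity
        nlinarith

theorem pair_count (θ τ : ℝ) (a : ℤ) (n v : ℕ) (u : ℤ) (hv : 1 ≤ v) (hcop : IsCoprime u (v : ℤ))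
    (herr : ((v : ℝ) - 1) * |v * θ - u| ≤ 1) (hτ : 0 ≤ τ) (T : Finset (ℤ × ℤ))
    (hT : ∀ z ∈ T, a ≤ z.1 ∧ z.1 < a + n ∧ |(z.2 : ℝ) - z.1 * θ| ≤ τ) :
    (T.card : ℝ) ≤ ((n : ℝ) / v + 1) * (2 * τ * v + 3) := by
  classical
  have hv0 : (0 : ℤ) < v := by exact_mod_cast hv
  have hvr : (1 : ℝ) ≤ v := by exact_mod_cast hv
  set g : ℤ × ℤ → ℤ := fun z => (z.1 - a) / v with hg
  set w : ℤ × ℤ → ℤ := fun z => z.2 * v - ((z.1 - a) % v) * u with hw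
  set M : ℕ := ⌊2 * τ * v + 3⌋₊ with hM
  have hfib : ∀ k ∈ T.image g, (T.filter (fun z => g z = k)).card ≤ M := by
    intro k _
    set c : ℝ := (a + k * v) * θ * v with hc
    have hmem : ∀ z ∈ T.filter (fun z => g z = k),
        w z ∈ Finset.Icc ⌈c - (τ * v + 1)⌉ ⌊c + (τ * v + 1)⌋ := by
      intro z hz
      rw [Finset.mem_filter] at hz
      obtain ⟨hzT, hzk⟩ := hz
      obtain ⟨h1, h2, h3⟩ := hT z hzT
      set i : ℤ := (z.1 - a) % v with hi
      have hi0 : 0 ≤ i := Int.emod_nonneg _ hv0.ne'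
      have hi1 : i < v := Int.emod_lt_of_pos _ hv0
      have hdecomp : z.1 = a + k * v + i := by
        have := Int.mul_ediv_add_emod (z.1 - a) v
        rw [← hi] at this
        simp only [hg] at hzk
        rw [hzk] at this
        linarith
      have hzr : (z.1 : ℝ) = a + k * v + i := by exact_mod_cast hdecomp
      have hir : (i : ℝ) ≤ v - 1 := by
        have : i ≤ v - 1 := by omega
        exact_mod_cast this
      have hi0r : (0 : ℝ) ≤ i := by exact_mod_cast hi0
      have e1 : ((w z : ℤ) : ℝ) - c = ((z.2 : ℝ) - z.1 * θ) * v + i * (v * θ - u) := by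
        simp only [hw, hc, ← hi]
        push_cast
        rw [hzr]; ring
      have e2 : |((w z : ℤ) : ℝ) - c| ≤ τ * v + 1 := by
        rw [e1]
        refine (abs_add_le _ _).trans ?_
        rw [abs_mul, abs_mul, abs_of_nonneg hi0r, abs_of_nonneg (by linarith : (0 : ℝ) ≤ v)]
        have := mul_le_mul_of_nonneg_right hir (abs_nonneg ((v : ℝ) * θ - u))
        have := mul_le_mul_of_nonneg_right h3 (by linarith : (0 : ℝ) ≤ v)
        linarith
      rw [abs_le] at e2
      rw [Finset.mem_Icc]
      exact ⟨Int.ceil_le.mpr (by linarith [e2.1]), Int.le_floor.mpr (by linarith [e2.2])⟩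
    have hinj : Set.InjOn w (T.filter (fun z => g z = k) : Finset (ℤ × ℤ)) := by
      intro z hz z' hz' hww
      rw [Finset.mem_coe, Finset.mem_filter] at hz hz'
      have hk := hz.2; have hk' := hz'.2
      simp only [hg] at hk hk'
      have d1 := Int.mul_ediv_add_emod (z.1 - a) v
      have d2 := Int.mul_ediv_add_emod (z'.1 - a) v
      rw [hk] at d1; rw [hk'] at d2
      have b1 : 0 ≤ (z.1 - a) % v := Int.emod_nonneg _ hv0.ne'
      have b2 : (z.1 - a) % v < v := Int.emod_lt_of_pos _ hv0
      have b1' : 0 ≤ (z'.1 - a) % v := Int.emod_nonneg _ hv0.ne'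
      have b2' : (z'.1 - a) % v < v := Int.emod_lt_of_pos _ hv0
      simp only [hw] at hww
      set i := (z.1 - a) % v
      set i' := (z'.1 - a) % v
      have hdvd : (v : ℤ) ∣ u * (i - i') := ⟨z.2 - z'.2, by linarith⟩
      have hdvd2 : (v : ℤ) ∣ (i - i') := hcop.symm.dvd_of_dvd_mul_left hdvd
      have hii : i = i' := by
        have : i - i' = 0 := Int.eq_zero_of_abs_lt_dvd hdvd2 (by rw [abs_lt]; constructor <;> linarith)
        linarith
      have h1 : z.1 = z'.1 := by linarith
      have h2 : z.2 = z'.2 := by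
        rw [hii] at hww
        have : z.2 * (v : ℤ) = z'.2 * v := by linarith
        exact mul_right_cancel₀ hv0.ne' this
      exact Prod.ext h1 h2
    have hcard := Finset.card_le_card_of_injOn w hmem hinj
    refine hcard.trans ?_
    rw [Int.card_Icc]
    apply Nat.le_floor
    have hnn : (0 : ℝ) ≤ 2 * τ * v + 3 := by positivity
    have : ((⌊c + (τ * v + 1)⌋ + 1 - ⌈c - (τ * v + 1)⌉ : ℤ) : ℝ) ≤ 2 * τ * v + 3 := by
      push_cast
      have := Int.floor_le (c + (τ * v + 1))
      have := Int.le_ceil (c - (τ * v + 1))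
      linarith
    rcases le_total 0 (⌊c + (τ * v + 1)⌋ + 1 - ⌈c - (τ * v + 1)⌉) with h | h
    · have e : (((⌊c + (τ * v + 1)⌋ + 1 - ⌈c - (τ * v + 1)⌉).toNat : ℕ) : ℝ) =
          ((⌊c + (τ * v + 1)⌋ + 1 - ⌈c - (τ * v + 1)⌉ : ℤ) : ℝ) := by
        exact_mod_cast Int.toNat_of_nonneg h
      rw [e]; exact this
    · rw [Int.toNat_of_nonpos h]; simpa using hnn
  have h1 := Finset.card_le_mul_card_image T M hfib
  have h2 : (T.image g).card ≤ n / v + 1 := by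
    have hsub : T.image g ⊆ Finset.Icc (0 : ℤ) ((n / v : ℕ) : ℤ) := by
      intro k hk
      rw [Finset.mem_image] at hk
      obtain ⟨z, hz, rfl⟩ := hk
      obtain ⟨h1, h2, _⟩ := hT z hz
      rw [Finset.mem_Icc]
      refine ⟨Int.ediv_nonneg (by linarith) hv0.le, ?_⟩
      rw [Int.natCast_div]
      exact Int.ediv_le_ediv hv0 (by linarith)
    have := Finset.card_le_card hsub
    rw [Int.card_Icc] at this
    generalize n / v = k at this ⊢
    omega
  have h3 : ((n / v : ℕ) : ℝ) ≤ (n : ℝ) / v := Nat.cast_div_le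
  have h4 : (M : ℝ) ≤ 2 * τ * v + 3 := Nat.floor_le (by positivity)
  calc (T.card : ℝ) ≤ ((M * (T.image g).card : ℕ) : ℝ) := by exact_mod_cast h1
    _ = (T.image g).card * (M : ℝ) := by push_cast; ring
    _ ≤ ((n / v + 1 : ℕ) : ℝ) * (2 * τ * v + 3) :=
        mul_le_mul (by exact_mod_cast h2) h4 (by positivity) (by positivity)
    _ ≤ _ := by
        apply mul_le_mul_of_nonneg_right _ (by positivity)
        push_cast; push_cast at h3; linarith

open MeasureTheory in
theorem overlap (q r : ℕ) (hq : 1 ≤ q) (hr : 1 ≤ r) (e b ℓ x0 : ℝ) (he : 0 ≤ e) (hb : 0 ≤ b)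
    (hℓ : 0 ≤ ℓ) (v : ℕ) (u : ℤ) (hv : 1 ≤ v) (hcop : IsCoprime u (v : ℤ))
    (herr : ((v : ℝ) - 1) * |v * ((q : ℝ) / r) - u| ≤ 1) :
    volume ({x : ℝ | nint (q * x) ≤ e} ∩ {x : ℝ | nint (r * x) ≤ b} ∩ Set.Icc x0 (x0 + ℓ)) ≤
      ENNReal.ofReal (((r * ℓ + 2) / v + 1) * (2 * (e + q * b / r) * v + 3) *
        min (2 * e / q) (2 * b / r)) := by
  classical
  have hq0 : (0 : ℝ) < q := by exact_mod_cast hq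
  have hr0 : (0 : ℝ) < r := by exact_mod_cast hr
  set θ : ℝ := (q : ℝ) / r with hθ
  set τ : ℝ := e + q * b / r with hτd
  have hτ : 0 ≤ τ := by positivity
  set a : ℤ := ⌈r * x0 - 1 / 2⌉ with ha
  set n : ℕ := ⌊r * ℓ⌋₊ + 2 with hn
  set T : Finset (ℤ × ℤ) := (Finset.Ico a (a + n)).biUnion
    (fun p => (Finset.Icc ⌈p * θ - τ⌉ ⌊p * θ + τ⌋).image (fun p' => (p, p'))) with hTdef
  have hmemT : ∀ z : ℤ × ℤ, z ∈ T ↔ a ≤ z.1 ∧ z.1 < a + n ∧ |(z.2 : ℝ) - z.1 * θ| ≤ τ := by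
    intro z
    simp only [hTdef, Finset.mem_biUnion, Finset.mem_Ico, Finset.mem_image, Finset.mem_Icc,
      Int.ceil_le, Int.le_floor, abs_le]
    constructor
    · rintro ⟨p, ⟨h1, h2⟩, p', ⟨h3, h4⟩, rfl⟩
      refine ⟨h1, h2, ?_, ?_⟩ <;> simp only <;> linarith
    · rintro ⟨h1, h2, h3, h4⟩
      exact ⟨z.1, ⟨h1, h2⟩, z.2, ⟨by linarith, by linarith⟩, rfl⟩
  have hcard := pair_count θ τ a n v u hv hcop herr hτ T (fun z hz => (hmemT z).1 hz)
  have hcov : ({x : ℝ | nint (q * x) ≤ e} ∩ {x : ℝ | nint (r * x) ≤ b} ∩ Set.Icc x0 (x0 + ℓ)) ⊆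
      ⋃ z ∈ T, (Set.Icc (((z.2 : ℝ) - e) / q) ((z.2 + e) / q) ∩
        Set.Icc (((z.1 : ℝ) - b) / r) ((z.1 + b) / r)) := by
    rintro x ⟨⟨hx1, hx2⟩, hx3, hx4⟩
    simp only [Set.mem_setOf_eq] at hx1 hx2
    have hx2' : |(r : ℝ) * x - round ((r : ℝ) * x)| ≤ 1 / 2 := nint_le_half _
    unfold nint at hx1 hx2
    set p := round ((r : ℝ) * x)
    set p' := round ((q : ℝ) * x)
    rw [Set.mem_iUnion₂]
    refine ⟨(p, p'), (hmemT _).2 ⟨?_, ?_, ?_⟩, ?_, ?_⟩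
    · rw [abs_le] at hx2'
      apply Int.ceil_le.mpr
      have := mul_le_mul_of_nonneg_left hx3 hr0.le
      linarith [hx2'.2]
    · rw [abs_le] at hx2'
      have h1 : (r : ℝ) * x ≤ r * x0 + r * ℓ := by
        rw [← mul_add]; exact mul_le_mul_of_nonneg_left hx4 hr0.le
      have h2 : r * x0 - 1 / 2 ≤ (a : ℝ) := Int.le_ceil _
      have h3 : r * ℓ < ⌊r * ℓ⌋₊ + 1 := Nat.lt_floor_add_one _
      have h4 : (p : ℝ) < a + n := by
        rw [hn]; push_cast; linarith [hx2'.1]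
      exact_mod_cast h4
    · show |(p' : ℝ) - p * θ| ≤ τ
      have e1 : (p' : ℝ) - p * θ = -((q : ℝ) * x - p') + θ * (r * x - p) := by
        rw [hθ]; field_simp; ring
      rw [e1]
      refine (abs_add_le _ _).trans ?_
      rw [abs_neg, abs_mul, abs_of_pos (by positivity : 0 < θ)]
      have : θ * |(r : ℝ) * x - p| ≤ θ * b := mul_le_mul_of_nonneg_left hx2 (by positivity)
      have e2 : θ * b = q * b / r := by rw [hθ]; ring
      rw [hτd, ← e2]; linarith
    · rw [abs_le] at hx1
      rw [Set.mem_Icc, div_le_iff₀ hq0, le_div_iff₀ hq0]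
      constructor <;> simp only <;> linarith
    · rw [abs_le] at hx2
      rw [Set.mem_Icc, div_le_iff₀ hr0, le_div_iff₀ hr0]
      constructor <;> simp only <;> linarith
  have hm : (0:ℝ) ≤ min (2 * e / q) (2 * b / r) := le_min (by positivity) (by positivity)
  calc _ ≤ volume (⋃ z ∈ T, (Set.Icc (((z.2 : ℝ) - e) / q) ((z.2 + e) / q) ∩
        Set.Icc (((z.1 : ℝ) - b) / r) ((z.1 + b) / r))) := measure_mono hcov
    _ ≤ ∑ z ∈ T, volume (Set.Icc (((z.2 : ℝ) - e) / q) ((z.2 + e) / q) ∩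
        Set.Icc (((z.1 : ℝ) - b) / r) ((z.1 + b) / r)) := measure_biUnion_finset_le _ _
    _ ≤ ∑ z ∈ T, ENNReal.ofReal (min (2 * e / q) (2 * b / r)) := by
        apply Finset.sum_le_sum
        intro z _
        rcases min_choice (2 * e / q) (2 * b / r) with h | h
        · rw [h]
          refine (measure_mono Set.inter_subset_left).trans ?_
          rw [Real.volume_Icc]
          apply ENNReal.ofReal_le_ofReal; apply le_of_eq; ring
        · rw [h]
          refine (measure_mono Set.inter_subset_right).trans ?_
          rw [Real.volume_Icc]
          apply ENNReal.ofReal_le_ofReal; apply le_of_eq; ring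
    _ = ENNReal.ofReal (T.card * min (2 * e / q) (2 * b / r)) := by
        rw [Finset.sum_const, ENNReal.ofReal_mul (by positivity), nsmul_eq_mul]
        simp
    _ ≤ _ := by
        apply ENNReal.ofReal_le_ofReal
        apply mul_le_mul_of_nonneg_right _ hm
        refine hcard.trans ?_
        apply mul_le_mul_of_nonneg_right _ (by positivity)
        have : (n : ℝ) ≤ r * ℓ + 2 := by
          rw [hn]; push_cast
          linarith [Nat.floor_le (by positivity : 0 ≤ r * ℓ)]
        gcongr

open MeasureTheory in
theorem vol_triv (q : ℕ) (hq : 1 ≤ q) (e ℓ x0 : ℝ) (he : 0 ≤ e) (heq : e ≤ q) (hℓ : 0 ≤ ℓ)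
    (hqℓ : 1 ≤ q * ℓ) :
    volume ({x : ℝ | nint (q * x) ≤ e} ∩ Set.Icc x0 (x0 + ℓ)) ≤ ENNReal.ofReal (56 * e * ℓ) := by
  have h := overlap 1 q le_rfl hq 1 e ℓ x0 zero_le_one he hℓ 1 0 le_rfl (by simpa using isCoprime_one_right) (by simp)
  have hq0 : (0 : ℝ) < q := by exact_mod_cast hq
  refine le_trans (measure_mono ?_) (h.trans (ENNReal.ofReal_le_ofReal ?_))
  · rintro x ⟨h1, h2⟩
    exact ⟨⟨(nint_le_half _).trans (by norm_num), h1⟩, h2⟩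
  · have h1 : e / q ≤ 1 := (div_le_one hq0).2 heq
    have h0 : 0 ≤ e / q := by positivity
    calc _ ≤ (4 * (q * ℓ)) * 7 * (2 * e / q) := by
          apply mul_le_mul _ (min_le_right _ _) (by positivity) (by positivity)
          push_cast
          apply mul_le_mul <;> first | positivity | skip
          · linarith
          · rw [one_mul]; linarith
      _ = _ := by field_simp; ring

open MeasureTheory in
theorem vol_swap (q r : ℕ) (hq : 1 ≤ q) (hr : 1 ≤ r) (e b ℓ x0 : ℝ) (he : 0 ≤ e) (hb : 0 ≤ b)
    (hb1 : b ≤ 1) (hℓ : 0 ≤ ℓ) (hqℓ : 1 ≤ q * ℓ) :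
    volume ({x : ℝ | nint (q * x) ≤ e} ∩ {x : ℝ | nint (r * x) ≤ b} ∩ Set.Icc x0 (x0 + ℓ)) ≤
      ENNReal.ofReal ((16 * e + 40 * (q / r)) * (b * ℓ)) := by
  have h := overlap r q hr hq b e ℓ x0 hb he hℓ 1 0 le_rfl (by simpa using isCoprime_one_right) (by simp)
  have hq0 : (0 : ℝ) < q := by exact_mod_cast hq
  have hr0 : (0 : ℝ) < r := by exact_mod_cast hr
  rw [Set.inter_comm {x : ℝ | nint (q * x) ≤ e}]
  refine h.trans (ENNReal.ofReal_le_ofReal ?_)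
  calc _ ≤ (4 * (q * ℓ)) * (5 + 2 * (r * e / q)) * (2 * b / r) := by
          apply mul_le_mul _ (min_le_left _ _) (by positivity) (by positivity)
          push_cast
          apply mul_le_mul <;> first | positivity | skip
          · linarith
          · linarith
      _ = _ := by field_simp; ring

open MeasureTheory in
theorem vol_main (q r : ℕ) (hq : 1 ≤ q) (hr : 1 ≤ r) (e b ℓ x0 : ℝ) (he : 0 ≤ e) (hb : 0 ≤ b)
    (hℓ : 0 < ℓ) (hrℓ : 1 ≤ r * ℓ) :
    volume ({x : ℝ | nint (q * x) ≤ e} ∩ {x : ℝ | nint (r * x) ≤ b} ∩ Set.Icc x0 (x0 + ℓ)) ≤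
      ENNReal.ofReal (80 * e * (b * ℓ)) ∨
    ∃ (v : ℕ) (u : ℤ), 1 ≤ v ∧ (v : ℝ) ≤ r * ℓ ∧ |(v : ℝ) * q - u * r| < 1 / ℓ ∧
      q * b / r * v < 1 := by
  have hq0 : (0 : ℝ) < q := by exact_mod_cast hq
  have hr0 : (0 : ℝ) < r := by exact_mod_cast hr
  have hn : 0 < ⌊r * ℓ⌋₊ := Nat.floor_pos.2 hrℓ
  obtain ⟨w, hw1, hw2⟩ := Real.exists_rat_abs_sub_le_and_den_le ((q : ℝ) / r) hn
  have hn1 : r * ℓ < (⌊r * ℓ⌋₊ : ℝ) + 1 := Nat.lt_floor_add_one _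
  have hn2 : (⌊r * ℓ⌋₊ : ℝ) ≤ r * ℓ := Nat.floor_le (by positivity)
  have hd0 : (0 : ℝ) < w.den := by exact_mod_cast w.den_pos
  have hdl : (w.den : ℝ) ≤ r * ℓ := le_trans (by exact_mod_cast hw2) hn2
  have hwe : (w : ℝ) = w.num / w.den := by exact_mod_cast (Rat.num_div_den w).symm
  have hkey : |(w.den : ℝ) * ((q : ℝ) / r) - w.num| ≤ 1 / ((⌊r * ℓ⌋₊ : ℝ) + 1) := by
    have : (w.den : ℝ) * ((q : ℝ) / r) - w.num = w.den * ((q : ℝ) / r - w) := by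
      rw [hwe]; field_simp
    rw [this, abs_mul, abs_of_pos hd0]
    calc _ ≤ (w.den : ℝ) * (1 / (((⌊r * ℓ⌋₊ : ℝ) + 1) * w.den)) := by gcongr
      _ = _ := by field_simp
  have hkey2 : |(w.den : ℝ) * ((q : ℝ) / r) - w.num| < 1 / (r * ℓ) :=
    hkey.trans_lt (one_div_lt_one_div_of_lt (by positivity) hn1)
  have hd1 : 1 ≤ w.den := w.den_pos
  have hd1' : (1 : ℝ) ≤ w.den := by exact_mod_cast hd1
  by_cases ht : 1 ≤ (e + q * b / r) * w.den
  · left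
    have h := overlap q r hq hr e b ℓ x0 he hb hℓ.le w.den w.num hd1
      (Rat.isCoprime_num_den w) ?_
    · refine h.trans (ENNReal.ofReal_le_ofReal ?_)
      have e1 : (r * ℓ + 2) / (w.den : ℝ) + 1 ≤ 4 * (r * ℓ) / w.den := by
        rw [div_add_one (by positivity)]
        gcongr
        linarith
      have e2 : 2 * (e + q * b / r) * w.den + 3 ≤ 5 * (e + q * b / r) * w.den := by linarith
      have e3 : (e + q * b / r) * min (2 * e / q) (2 * b / r) ≤ 4 * e * b / r := by
        have a1 : e * min (2 * e / q) (2 * b / r) ≤ e * (2 * b / r) := by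
          gcongr; exact min_le_right _ _
        have a2 : (q * b / r) * min (2 * e / q) (2 * b / r) ≤ (q * b / r) * (2 * e / q) := by
          gcongr; exact min_le_left _ _
        have a3 : (q * b / r) * (2 * e / q) = e * (2 * b / r) := by field_simp
        have a4 : 4 * e * b / r = 2 * (e * (2 * b / r)) := by ring
        rw [add_mul]; linarith
      have hm : 0 ≤ min (2 * e / q) (2 * b / r) := by positivity
      calc _ ≤ (4 * (r * ℓ) / w.den) * (5 * (e + q * b / r) * w.den) *
              min (2 * e / q) (2 * b / r) := by
            gcongr
        _ = 20 * (r * ℓ) * ((e + q * b / r) * min (2 * e / q) (2 * b / r)) := by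
            field_simp; ring
        _ ≤ 20 * (r * ℓ) * (4 * e * b / r) := by gcongr
        _ = _ := by field_simp; ring
    · calc ((w.den : ℝ) - 1) * |w.den * ((q : ℝ) / r) - w.num| ≤ (r * ℓ) * (1 / (r * ℓ)) := by
            apply mul_le_mul _ hkey2.le (by positivity) (by positivity)
            linarith
        _ = 1 := by field_simp
  · right
    refine ⟨w.den, w.num, hd1, hdl, ?_, ?_⟩
    · have : (w.den : ℝ) * q - w.num * r = r * (w.den * ((q : ℝ) / r) - w.num) := by
        field_simp
      rw [this, abs_mul, abs_of_pos hr0]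
      calc _ < (r : ℝ) * (1 / (r * ℓ)) := by gcongr
        _ = _ := by field_simp
    · push Not at ht
      have : 0 ≤ e * w.den := by positivity
      rw [add_mul] at ht; linarith

theorem bad_nint {α δ : ℝ} (hδ : 0 < δ) (hδ1 : δ ≤ 1 / 2)
    (hα : ∀ q : ℕ, 1 ≤ q → δ ≤ (q : ℝ) * nint (q * α))
    (q r : ℕ) (hr : 1 ≤ r) (p0 : ℤ) (η T : ℝ) (hT : 1 ≤ T) (hp : |(r : ℝ) * α - p0| ≤ η)
    (hcop : IsCoprime p0 (r : ℤ)) (v : ℕ) (u : ℤ) (hv : 1 ≤ v)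
    (hvu : |(v : ℝ) * q - u * r| < T) (hu : 0 ≤ u) (huη : u * η ≤ δ / (2 * T)) (hrq : ¬ r ∣ q) :
    δ / (2 * T) ≤ v * nint (q * α) := by
  have hv0 : (0 : ℝ) < v := by exact_mod_cast hv
  have hu0 : (0 : ℝ) ≤ u := by exact_mod_cast hu
  have hs : nint (q * α) = |q * α - round (q * α)| := rfl
  have hvs : |v * (q * α) - v * round (q * α)| = v * nint (q * α) := by
    rw [hs, ← mul_sub, abs_mul, abs_of_pos hv0]
  have hup : |u * ((r : ℝ) * α) - u * p0| ≤ δ / (2 * T) := by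
    rw [← mul_sub, abs_mul, abs_of_nonneg hu0]
    exact (mul_le_mul_of_nonneg_left hp hu0).trans huη
  have hq4 : δ / (2 * T) ≤ 1 / 4 := by
    rw [div_le_iff₀ (by linarith)]; linarith
  by_contra hcon
  push Not at hcon
  by_cases ht : (v : ℤ) * q - u * r = 0
  · have htr : (v : ℝ) * q = u * r := by
      have : (((v : ℤ) * q - u * r : ℤ) : ℝ) = 0 := by rw [ht]; simp
      push_cast at this; linarith
    have h1 : |((v * round (q * α) - u * p0 : ℤ) : ℝ)| < 1 := by
      push_cast
      have e : (v : ℝ) * round (q * α) - u * p0 =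
          (u * ((r : ℝ) * α) - u * p0) - (v * (q * α) - v * round (q * α)) := by
        linear_combination α * htr
      rw [e]
      refine (abs_sub _ _).trans_lt ?_
      rw [hvs]; linarith
    have h2 : (v : ℤ) * round (q * α) - u * p0 = 0 := by
      rw [← Int.abs_lt_one_iff]; exact_mod_cast h1
    have h3 : (q : ℤ) * p0 = r * round (q * α) := by
      have hvz : (v : ℤ) ≠ 0 := by positivity
      apply mul_left_cancel₀ hvz
      linear_combination p0 * ht - r * h2
    apply hrq
    have h4 : (r : ℤ) ∣ q * p0 := ⟨_, h3⟩
    have h5 : (r : ℤ) ∣ q := hcop.symm.dvd_of_dvd_mul_right h4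
    exact_mod_cast h5
  · have h1 := nint_int_ge hα _ ht
    have h2 : nint ((((v : ℤ) * q - u * r : ℤ) : ℝ) * α) < δ / T := by
      refine (nint_le _ (v * round (q * α) - u * p0)).trans_lt ?_
      have e : (((v : ℤ) * q - u * r : ℤ) : ℝ) * α - ((v * round (q * α) - u * p0 : ℤ) : ℝ) =
          (v * (q * α) - v * round (q * α)) - (u * ((r : ℝ) * α) - u * p0) := by
        push_cast; ring
      rw [e]
      refine (abs_sub _ _).trans_lt ?_
      rw [hvs]
      have : δ / T = δ / (2 * T) + δ / (2 * T) := by field_simp; norm_num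
      linarith
    have h3 : |(((v : ℤ) * q - u * r : ℤ) : ℝ)| < T := by push_cast; exact hvu
    have h4 : |(((v : ℤ) * q - u * r : ℤ) : ℝ)| * nint ((((v : ℤ) * q - u * r : ℤ) : ℝ) * α) <
        T * (δ / T) := by
      apply mul_lt_mul'' h3 h2 (abs_nonneg _) (nint_nonneg _)
    have h5 : T * (δ / T) = δ := by field_simp
    linarith

theorem nint_mul_eq {α : ℝ} (r m : ℕ) (p0 : ℤ) (η : ℝ) (hp : |(r : ℝ) * α - p0| ≤ η)
    (hm : m * η < 1 / 2) (hm1 : 1 ≤ m) : nint (((m * r : ℕ) : ℝ) * α) = m * nint (r * α) := by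
  have hm0 : (1 : ℝ) ≤ m := by exact_mod_cast hm1
  have hη : 0 ≤ η := (abs_nonneg _).trans hp
  have h1 : nint (r * α) = |(r : ℝ) * α - p0| := by
    apply nint_eq_of_lt
    nlinarith
  have h2 : |((m * r : ℕ) : ℝ) * α - ((m * p0 : ℤ) : ℝ)| = m * |(r : ℝ) * α - p0| := by
    push_cast
    rw [mul_assoc, ← mul_sub, abs_mul, abs_of_nonneg (by linarith)]
  rw [h1, ← h2]
  apply nint_eq_of_lt
  rw [h2]
  calc _ ≤ (m : ℝ) * η := by gcongr
    _ < _ := hm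

/-- count of numbers `q` having a relation with small `u` -/
theorem bad_count (N : ℕ) (r U T D X : ℕ) (F : Finset ℕ)
    (hD : ∀ n : ℕ, 1 ≤ n → n ≤ X → n.divisors.card ≤ D)
    (hF : ∀ q ∈ F, ∃ (v : ℕ) (u : ℤ), 1 ≤ v ∧ 1 ≤ q ∧ 1 ≤ u ∧ u ≤ U ∧ |(v : ℤ) * q - u * r| < T ∧
      v * q ≤ X) : F.card ≤ U * (2 * T) * D := by
  classical
  have hsub : F ⊆ ((Finset.Icc (1 : ℤ) U) ×ˢ (Finset.Ioo (-(T : ℤ)) T)).biUnion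
      (fun z => if (z.1 * r + z.2).toNat ≤ X ∧ 1 ≤ (z.1 * r + z.2).toNat then
        (z.1 * r + z.2).toNat.divisors else ∅) := by
    intro q hq
    obtain ⟨v, u, hv, hq1, hu1, hu, ht, hX⟩ := hF q hq
    rw [Finset.mem_biUnion]
    refine ⟨(u, (v : ℤ) * q - u * r), ?_, ?_⟩
    · rw [Finset.mem_product, Finset.mem_Icc, Finset.mem_Ioo]
      exact ⟨⟨hu1, hu⟩, abs_lt.1 ht⟩
    · have e : (u * r + ((v : ℤ) * q - u * r)).toNat = v * q := by
        rw [add_sub_cancel]; exact_mod_cast Int.toNat_natCast (v * q)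
      have : 1 ≤ v * q := Nat.mul_pos hv hq1
      simp only [e]
      rw [if_pos ⟨hX, this⟩, Nat.mem_divisors]
      exact ⟨Dvd.intro_left _ rfl, by omega⟩
  refine (Finset.card_le_card hsub).trans (Finset.card_biUnion_le.trans ?_)
  refine (Finset.sum_le_card_nsmul _ _ D ?_).trans ?_
  · intro z _
    split_ifs with h
    · exact hD _ h.2 h.1
    · simp
  · rw [Finset.card_product, Int.card_Icc, Int.card_Ioo, smul_eq_mul]
    gcongr
    · omega
    · omega

noncomputable def epsq (α c : ℝ) (q : ℕ) : ℝ := c / ((q : ℝ) * (Real.log q) ^ 2 * nint (q * α))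

theorem log_sq_ge {q n : ℕ} (hq : 2 ^ n ≤ q) : ((n : ℝ) / 2) ^ 2 ≤ (Real.log q) ^ 2 := by
  have h2 : (1 : ℝ) / 2 ≤ Real.log 2 := by linarith [Real.log_two_gt_d9]
  have h : (n : ℝ) * Real.log 2 ≤ Real.log q := by
    rw [← Real.log_pow]
    exact Real.log_le_log (by positivity) (by exact_mod_cast hq)
  have h3 : (n : ℝ) / 2 ≤ n * Real.log 2 := by
    have : (0 : ℝ) ≤ n := by positivity
    nlinarith
  apply pow_le_pow_left₀ (by positivity)
  linarith

theorem nint_pos {α δ : ℝ} (hδ : 0 < δ) (hα : ∀ q : ℕ, 1 ≤ q → δ ≤ (q : ℝ) * nint (q * α))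
    (q : ℕ) (hq : 1 ≤ q) : 0 < nint (q * α) := by
  have h := hα q hq
  have h1 := nint_nonneg (q * α)
  rcases h1.lt_or_eq with h2 | h2
  · exact h2
  · rw [← h2] at h; linarith

theorem epsq_nonneg (α c : ℝ) (hc : 0 ≤ c) (q : ℕ) : 0 ≤ epsq α c q := by
  have := nint_nonneg (q * α)
  unfold epsq; positivity

theorem epsq_le {α δ : ℝ} (hδ : 0 < δ) (hα : ∀ q : ℕ, 1 ≤ q → δ ≤ (q : ℝ) * nint (q * α))
    (c : ℝ) (hc : 0 ≤ c) (q : ℕ) (hq : 2 ≤ q) : epsq α c q ≤ 4 * c / δ := by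
  have h1 := hα q (by omega)
  have h2 := log_sq_ge (q := q) (n := 1) (by simpa using hq)
  have hp := nint_pos hδ hα q (by omega)
  have hq0 : (0 : ℝ) < q := by positivity
  have h3 : δ / 4 ≤ (q : ℝ) * (Real.log q) ^ 2 * nint (q * α) := by
    have : (q : ℝ) * (Real.log q) ^ 2 * nint (q * α) = ((q : ℝ) * nint (q * α)) * (Real.log q) ^ 2 := by ring
    rw [this]
    calc δ / 4 = δ * (1 / 4) := by ring
      _ ≤ _ := by
        apply mul_le_mul h1 _ (by norm_num) (by positivity)
        norm_num at h2 ⊢; linarith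
  unfold epsq
  rw [div_le_div_iff₀ (by linarith) hδ]
  nlinarith

theorem sum_blocks (f : ℕ → ℝ) (a b : ℕ) (hab : a ≤ b) :
    ∑ q ∈ Finset.Ico ((2 : ℕ) ^ a) (2 ^ b), f q =
      ∑ n ∈ Finset.Ico a b, ∑ q ∈ Finset.Ico ((2 : ℕ) ^ n) (2 ^ (n + 1)), f q := by
  induction b, hab using Nat.le_induction with
  | base => simp
  | succ b hab ih =>
    rw [Finset.sum_Ico_succ_top hab, ← ih, Finset.sum_Ico_consecutive]
    · exact Nat.pow_le_pow_right (by norm_num) hab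
    · exact Nat.pow_le_pow_right (by norm_num) (by omega)

theorem eps_sum {α δ : ℝ} (hδ : 0 < δ) (hα : ∀ q : ℕ, 1 ≤ q → δ ≤ (q : ℝ) * nint (q * α)) :
    ∃ C, 0 < C ∧ ∀ c : ℝ, 0 ≤ c → ∀ n : ℕ, 1 ≤ n →
      ∑ q ∈ Finset.Ico ((2 : ℕ) ^ n) (2 ^ (64 * n)), epsq α c q ≤ c * C := by
  obtain ⟨C, hC, hb⟩ := block_sum hδ hα
  refine ⟨252 * C, by positivity, ?_⟩
  intro c hc n hn
  rw [sum_blocks _ _ _ (by omega)]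
  have hn0 : (0 : ℝ) < n := by exact_mod_cast hn
  have hblock : ∀ k ∈ Finset.Ico n (64 * n),
      ∑ q ∈ Finset.Ico ((2 : ℕ) ^ k) (2 ^ (k + 1)), epsq α c q ≤ 4 * c * C / n := by
    intro k hk
    rw [Finset.mem_Ico] at hk
    have hk1 : 1 ≤ k := by omega
    have hk0 : (0 : ℝ) < k := by exact_mod_cast hk1
    have hkn : (n : ℝ) ≤ k := by exact_mod_cast hk.1
    calc ∑ q ∈ Finset.Ico ((2 : ℕ) ^ k) (2 ^ (k + 1)), epsq α c q
        ≤ ∑ q ∈ Finset.Ico ((2 : ℕ) ^ k) (2 ^ (k + 1)),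
            (4 * c / (k : ℝ) ^ 2) * (1 / ((q : ℝ) * nint (q * α))) := by
          apply Finset.sum_le_sum
          intro q hq
          rw [Finset.mem_Ico] at hq
          have hq1 : 1 ≤ q := le_trans Nat.one_le_two_pow hq.1
          have hq0 : (0 : ℝ) < q := by exact_mod_cast hq1
          have hp := nint_pos hδ hα q hq1
          have hl := log_sq_ge hq.1
          have hl0 : 0 < ((k : ℝ) / 2) ^ 2 := by positivity
          unfold epsq
          calc c / ((q : ℝ) * (Real.log q) ^ 2 * nint (q * α))
              ≤ c / ((q : ℝ) * ((k : ℝ) / 2) ^ 2 * nint (q * α)) := by gcongr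
            _ = _ := by field_simp; norm_num
      _ = (4 * c / (k : ℝ) ^ 2) *
            ∑ q ∈ Finset.Ico ((2 : ℕ) ^ k) (2 ^ (k + 1)), (1 / ((q : ℝ) * nint (q * α))) := by
          rw [Finset.mul_sum]
      _ ≤ (4 * c / (k : ℝ) ^ 2) * (C * k) := by
          gcongr
          exact hb k hk1
      _ = 4 * c * C / k := by field_simp
      _ ≤ _ := by gcongr
  refine (Finset.sum_le_card_nsmul _ _ _ hblock).trans ?_
  rw [Nat.card_Ico, nsmul_eq_mul]
  have : ((64 * n - n : ℕ) : ℝ) = 63 * n := by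
    have : 64 * n - n = 63 * n := by omega
    rw [this]; push_cast; ring
  rw [this]
  apply le_of_eq
  field_simp
  ring

set_option maxHeartbeats 2000000 in
open MeasureTheory in
theorem KE_q {α δ : ℝ} (hδ : 0 < δ) (hδ1 : δ ≤ 1 / 2)
    (hα : ∀ q : ℕ, 1 ≤ q → δ ≤ (q : ℝ) * nint (q * α)) (c : ℝ) (hc : 0 < c) (hcδ : c ≤ δ / 4)
    (q r Y W : ℕ) (p0 : ℤ) (hW : 1 ≤ W) (hbig : (2 : ℝ) ^ 180 * (W : ℝ) ^ 2 ≤ δ ^ 2 * Y)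
    (hr1 : r ≤ Y ^ 128) (hr2 : δ * (Y : ℝ) ^ 128 ≤ r) (hp : |(r : ℝ) * α - p0| ≤ 1 / (Y : ℝ) ^ 128)
    (hcop : IsCoprime p0 (r : ℤ)) (hlog : (W : ℝ) ≤ 4 * (Real.log r) ^ 2) (hr : 1 ≤ r)
    (hq : Y ^ 4 ≤ q) (x0 : ℝ) (μ : ENNReal)
    (hμ : μ = volume ({x : ℝ | nint (q * x) ≤ 2 * epsq α c q} ∩
      {x : ℝ | nint (r * x) ≤ 1 / W} ∩ Set.Icc x0 (x0 + 1 / (Y : ℝ) ^ 4))) :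
    μ ≤ ENNReal.ofReal (160 * epsq α c q * (1 / W * (1 / (Y : ℝ) ^ 4))) ∨
    ((∃ (v : ℕ) (u : ℤ), 1 ≤ v ∧ 1 ≤ q ∧ 1 ≤ u ∧ u ≤ (2 * W : ℕ) ∧
        |(v : ℤ) * q - u * r| < (Y ^ 4 : ℕ) ∧ v * q ≤ Y ^ 128 * W) ∧
      μ ≤ ENNReal.ofReal ((160 * epsq α c q + 40 / (Y : ℝ) ^ 40) * (1 / W * (1 / (Y : ℝ) ^ 4)))) ∨
    (∃ m : ℕ, 1 ≤ m ∧ q = m * r ∧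
      μ ≤ ENNReal.ofReal (448 * c / (m ^ 2 * δ) * (1 / W * (1 / (Y : ℝ) ^ 4)))) := by
  have hW0 : (1 : ℝ) ≤ W := by exact_mod_cast hW
  have hr0 : (0 : ℝ) < r := by exact_mod_cast hr
  have hYbig : (2 : ℝ) ^ 180 * (W : ℝ) ≤ δ * Y := by
    have h1 : (2 : ℝ) ^ 180 * (W : ℝ) ≤ 2 ^ 180 * (W : ℝ) ^ 2 := by
      apply mul_le_mul_of_nonneg_left _ (by positivity); nlinarith
    have h2 : δ ^ 2 * Y ≤ δ * Y := by
      apply mul_le_mul_of_nonneg_right _ (by positivity); nlinarith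
    linarith
  have hYW : (2 : ℝ) ^ 180 * (W : ℝ) ≤ Y := by
    have h0 : (0 : ℝ) ≤ Y := by positivity
    nlinarith
  have hY1 : (2 : ℝ) ^ 180 ≤ Y := by
    refine le_trans ?_ hYW
    apply le_mul_of_one_le_right (by positivity) hW0
  have hY2 : (1 : ℝ) ≤ Y := le_trans (by norm_num) hY1
  have hY0 : (0 : ℝ) < Y := by linarith
  have hpow : ∀ n : ℕ, 1 ≤ n → (Y : ℝ) ≤ (Y : ℝ) ^ n := fun n hn =>
    le_self_pow₀ hY2 (by omega)
  have hqY : (Y : ℝ) ^ 4 ≤ q := by exact_mod_cast hq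
  have hq2r : (2 : ℝ) ≤ q := by
    have := hpow 4 (by norm_num)
    have : (2 : ℝ) ≤ 2 ^ 180 := by norm_num
    linarith
  have hq2 : 2 ≤ q := by exact_mod_cast hq2r
  have hq0 : (0 : ℝ) < q := by linarith
  have he0 := epsq_nonneg α c hc.le q
  have hele : 2 * epsq α c q ≤ q := by
    have := epsq_le hδ hα c hc.le q hq2
    have : 4 * c / δ ≤ 1 := by rw [div_le_one hδ]; linarith
    linarith
  have hℓ0 : 0 < 1 / (Y : ℝ) ^ 4 := by positivity
  have hqℓ : 1 ≤ q * (1 / (Y : ℝ) ^ 4) := by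
    rw [mul_one_div, le_div_iff₀ (by positivity)]; linarith
  have hrY4 : (Y : ℝ) ^ 4 ≤ r := by
    refine le_trans ?_ hr2
    have h1 : 1 ≤ δ * Y := by
      refine le_trans ?_ hYbig
      nlinarith
    calc (Y : ℝ) ^ 4 ≤ (Y : ℝ) ^ 127 := pow_le_pow_right₀ hY2 (by norm_num)
      _ = 1 * (Y : ℝ) ^ 127 := by ring
      _ ≤ (δ * Y) * (Y : ℝ) ^ 127 := by gcongr
      _ = _ := by ring
  have hrℓ : 1 ≤ r * (1 / (Y : ℝ) ^ 4) := by
    rw [mul_one_div, le_div_iff₀ (by positivity)]; linarith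
  have htriv : μ ≤ ENNReal.ofReal (56 * (2 * epsq α c q) * (1 / (Y : ℝ) ^ 4)) := by
    rw [hμ]
    refine le_trans (measure_mono ?_) (vol_triv q (by omega) (2 * epsq α c q) (1 / (Y : ℝ) ^ 4) x0
      (by positivity) hele hℓ0.le hqℓ)
    exact Set.inter_subset_inter_left _ Set.inter_subset_left
  rcases vol_main q r (by omega) hr (2 * epsq α c q) (1 / W) (1 / (Y : ℝ) ^ 4) x0 (by positivity)
    (by positivity) hℓ0 hrℓ with h | ⟨v, u, hv1, hvr, hvu, hvb⟩
  · left
    rw [hμ]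
    refine h.trans (ENNReal.ofReal_le_ofReal (le_of_eq ?_))
    ring
  · right
    rw [one_div_one_div] at hvu
    have hv0 : (1 : ℝ) ≤ v := by exact_mod_cast hv1
    have hvq : (v : ℝ) * q < r * W := by
      have : (q : ℝ) * (1 / W) / r * v = (v * q) / (r * W) := by field_simp
      rw [this, div_lt_one (by positivity)] at hvb
      exact hvb
    have hvu' := abs_lt.1 hvu
    have hu1 : 1 ≤ u := by
      by_contra hu
      have hu' : (u : ℝ) ≤ 0 := by exact_mod_cast (by omega : u ≤ 0)
      have : (q : ℝ) ≤ v * q := le_mul_of_one_le_left hq0.le hv0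
      nlinarith
    have hu1r : (1 : ℝ) ≤ u := by exact_mod_cast hu1
    have hu2r : (u : ℝ) ≤ 2 * W := by
      have h1 : (u : ℝ) * r ≤ (2 * W) * r := by nlinarith
      exact le_of_mul_le_mul_right h1 hr0
    have hη : (2 * W : ℝ) * (1 / (Y : ℝ) ^ 128) ≤ δ / (2 * (Y : ℝ) ^ 4) := by
      rw [mul_one_div, div_le_div_iff₀ (by positivity) (by positivity)]
      have h1 : 2 * (W : ℝ) * 2 ≤ δ * Y := by
        refine le_trans ?_ hYbig
        nlinarith
      calc 2 * (W : ℝ) * (2 * (Y : ℝ) ^ 4) = (2 * W * 2) * (Y : ℝ) ^ 4 := by ring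
        _ ≤ (δ * Y) * (Y : ℝ) ^ 127 := by
            apply mul_le_mul h1 (pow_le_pow_right₀ hY2 (by norm_num)) (by positivity) (by positivity)
        _ = _ := by ring
    by_cases hdvd : r ∣ q
    · right
      obtain ⟨m, hm⟩ := hdvd
      have hm' : q = m * r := by rw [hm, mul_comm]
      have hm1 : 1 ≤ m := by
        rcases Nat.eq_zero_or_pos m with h | h
        · rw [h] at hm'; omega
        · exact h
      have hm1r : (1 : ℝ) ≤ m := by exact_mod_cast hm1
      refine ⟨m, hm1, hm', htriv.trans (ENNReal.ofReal_le_ofReal ?_)⟩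
      have hqm : (q : ℝ) = m * r := by rw [hm']; push_cast; ring
      have hmW : (m : ℝ) ≤ 2 * W := by
        have h1 : (m : ℝ) * r ≤ W * r := by
          rw [← hqm]
          have : (q : ℝ) ≤ v * q := le_mul_of_one_le_left hq0.le hv0
          nlinarith
        have := le_of_mul_le_mul_right h1 hr0
        linarith
      have hmη : m * (1 / (Y : ℝ) ^ 128) < 1 / 2 := by
        have h1 : (m : ℝ) * (1 / (Y : ℝ) ^ 128) ≤ 2 * W * (1 / (Y : ℝ) ^ 128) := by gcongr
        have h2 : δ / (2 * (Y : ℝ) ^ 4) ≤ δ / 2 := by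
          apply div_le_div_of_nonneg_left hδ.le (by norm_num)
          have := one_le_pow₀ hY2 (n := 4)
          linarith
        linarith
      have hn := nint_mul_eq r m p0 _ hp hmη hm1
      rw [← hm'] at hn
      have hrr := hα r hr
      have hnr := nint_pos hδ hα r hr
      have hlogq : (W : ℝ) / 4 ≤ Real.log q ^ 2 := by
        have h1 : Real.log r ≤ Real.log q := by
          apply Real.log_le_log hr0
          rw [hqm]; nlinarith
        have h2 : 0 ≤ Real.log r := Real.log_nonneg (by exact_mod_cast hr)
        have := pow_le_pow_left₀ h2 h1 2
        linarith
      have hden : m ^ 2 * δ * (W / 4) ≤ (q : ℝ) * (Real.log q) ^ 2 * nint (q * α) := by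
        rw [hn]
        have : (q : ℝ) * (Real.log q) ^ 2 * (m * nint (r * α)) =
          (m ^ 2 * (r * nint (r * α))) * (Real.log q) ^ 2 := by
          rw [hqm]; ring
        rw [this]
        gcongr
      have he : epsq α c q ≤ c / (m ^ 2 * δ * (W / 4)) := by
        unfold epsq
        apply div_le_div_of_nonneg_left hc.le (by positivity) hden
      calc 56 * (2 * epsq α c q) * (1 / (Y : ℝ) ^ 4)
          ≤ 56 * (2 * (c / (m ^ 2 * δ * (W / 4)))) * (1 / (Y : ℝ) ^ 4) := by gcongr
        _ = _ := by field_simp; ring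
    · left
      refine ⟨⟨v, u, hv1, by omega, hu1, by exact_mod_cast hu2r, ?_, ?_⟩, ?_⟩
      · have : |(((v : ℤ) * q - u * r : ℤ) : ℝ)| < (((Y ^ 4 : ℕ) : ℤ) : ℝ) := by
          push_cast; exact hvu
        exact_mod_cast this
      · have h1 : (v : ℝ) * q ≤ (Y : ℝ) ^ 128 * W := by
          refine hvq.le.trans ?_
          gcongr
          exact_mod_cast hr1
        exact_mod_cast h1
      · have hb := bad_nint hδ hδ1 hα q r hr p0 _ ((Y : ℝ) ^ 4) (one_le_pow₀ hY2) hp hcop v u hv1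
          hvu (by omega) (le_trans (by gcongr) hη) hdvd
        rcases le_or_gt ((q : ℝ) / r) (1 / (Y : ℝ) ^ 40) with hy | hy
        · rw [hμ]
          refine (vol_swap q r (by omega) hr (2 * epsq α c q) (1 / W) (1 / (Y : ℝ) ^ 4) x0
            (by positivity) (by positivity) (by rw [div_le_one (by linarith)]; exact hW0)
            hℓ0.le hqℓ).trans (ENNReal.ofReal_le_ofReal ?_)
          apply mul_le_mul_of_nonneg_right _ (by positivity)
          have : 40 / (Y : ℝ) ^ 40 = 40 * (1 / (Y : ℝ) ^ 40) := by ring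
          rw [this]
          linarith
        · refine htriv.trans (ENNReal.ofReal_le_ofReal ?_)
          have hlogq : (1 : ℝ) / 4 ≤ Real.log q ^ 2 := by
            have := log_sq_ge (q := q) (n := 1) (by simpa using hq2)
            norm_num at this ⊢; linarith
          have hnq := nint_pos hδ hα q (by omega)
          have hn : δ * q / (2 * (Y : ℝ) ^ 4 * (r * W)) ≤ nint (q * α) := by
            rw [div_le_iff₀ (by positivity)] at hb ⊢
            calc δ * q ≤ (v * nint (q * α) * (2 * (Y : ℝ) ^ 4)) * q := by gcongr
              _ = nint (q * α) * (2 * (Y : ℝ) ^ 4 * (v * q)) := by ring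
              _ ≤ _ := by gcongr
          have hqr : (r : ℝ) / (Y : ℝ) ^ 40 ≤ q := by
            rw [lt_div_iff₀ hr0] at hy
            have : (r : ℝ) / (Y : ℝ) ^ 40 = 1 / (Y : ℝ) ^ 40 * r := by ring
            linarith
          have he : epsq α c q ≤ c / ((r / (Y : ℝ) ^ 40) * (1 / 4) *
              (δ * (r / (Y : ℝ) ^ 40) / (2 * (Y : ℝ) ^ 4 * (r * W)))) := by
            unfold epsq
            apply div_le_div_of_nonneg_left hc.le (by positivity)
            apply mul_le_mul (by gcongr) (le_trans (by gcongr) hn) (by positivity) (by positivity)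
          have he2 : epsq α c q ≤ 8 * c * W / (δ ^ 2 * (Y : ℝ) ^ 44) := by
            refine he.trans ?_
            have : c / ((r / (Y : ℝ) ^ 40) * (1 / 4) *
              (δ * (r / (Y : ℝ) ^ 40) / (2 * (Y : ℝ) ^ 4 * (r * W)))) =
              8 * c * W * (Y : ℝ) ^ 84 / (δ * r) := by field_simp; ring
            rw [this]
            calc 8 * c * W * (Y : ℝ) ^ 84 / (δ * r) ≤ 8 * c * W * (Y : ℝ) ^ 84 /
                  (δ * (δ * (Y : ℝ) ^ 128)) := by gcongr
              _ = _ := by field_simp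
          have he3 : 112 * epsq α c q * W ≤ 40 / (Y : ℝ) ^ 40 := by
            calc 112 * epsq α c q * W ≤ 112 * (8 * c * W / (δ ^ 2 * (Y : ℝ) ^ 44)) * W := by gcongr
              _ = 896 * c * (W : ℝ) ^ 2 / (δ ^ 2 * Y) / (Y : ℝ) ^ 43 := by field_simp; ring
              _ ≤ 40 / (Y : ℝ) ^ 43 := by
                  gcongr
                  rw [div_le_iff₀ (by positivity)]
                  have : c ≤ 1 := by linarith
                  have hw2 : 0 < (W : ℝ) ^ 2 := by positivity
                  have : 896 * c * (W : ℝ) ^ 2 ≤ 896 * 1 * (W : ℝ) ^ 2 := by gcongr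
                  nlinarith
              _ ≤ _ := by
                  gcongr
                  norm_num
          calc 56 * (2 * epsq α c q) * (1 / (Y : ℝ) ^ 4)
              = (112 * epsq α c q * W) * (1 / W * (1 / (Y : ℝ) ^ 4)) := by field_simp; ring
            _ ≤ (160 * epsq α c q + 40 / (Y : ℝ) ^ 40) * (1 / W * (1 / (Y : ℝ) ^ 4)) := by
                gcongr
                linarith

theorem sum_dvd_le (r N M : ℕ) (hr : 1 ≤ r) (A : ℝ) (hA : 0 ≤ A) (hN : 1 ≤ N) :
    ∑ q ∈ (Finset.Ico N M).filter (fun q => r ∣ q), A * (((q / r : ℕ) : ℝ) ^ 2)⁻¹ ≤ 2 * A := by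
  classical
  rw [← Finset.mul_sum]
  have h1 : ∑ q ∈ (Finset.Ico N M).filter (fun q => r ∣ q), (((q / r : ℕ) : ℝ) ^ 2)⁻¹ =
      ∑ m ∈ ((Finset.Ico N M).filter (fun q => r ∣ q)).image (fun q => q / r), ((m : ℝ) ^ 2)⁻¹ := by
    rw [Finset.sum_image]
    intro a ha b hb hab
    simp only [Finset.coe_filter, Set.mem_setOf_eq] at ha hb
    exact (Nat.div_left_inj ha.2 hb.2).1 hab
  have h2 : ((Finset.Ico N M).filter (fun q => r ∣ q)).image (fun q => q / r) ⊆ Finset.Ioo 0 M := by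
    intro m hm
    rw [Finset.mem_image] at hm
    obtain ⟨q, hq, rfl⟩ := hm
    rw [Finset.mem_filter, Finset.mem_Ico] at hq
    rw [Finset.mem_Ioo]
    refine ⟨Nat.div_pos (Nat.le_of_dvd (by omega) hq.2) hr, ?_⟩
    exact lt_of_le_of_lt (Nat.div_le_self _ _) hq.1.2
  have h3 := sum_Ioo_inv_sq_le (α := ℝ) 0 M
  have h4 := Finset.sum_le_sum_of_subset_of_nonneg h2
    (f := fun m : ℕ => ((m : ℝ) ^ 2)⁻¹) (fun i _ _ => by positivity)
  rw [h1]
  norm_num at h3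
  have : ∑ m ∈ ((Finset.Ico N M).filter (fun q => r ∣ q)).image (fun q => q / r), ((m : ℝ) ^ 2)⁻¹ ≤ 2 :=
    h4.trans (by simpa using h3)
  nlinarith

set_option maxHeartbeats 1000000 in
open MeasureTheory in
theorem KE {α δ : ℝ} (hδ : 0 < δ) (hδ1 : δ ≤ 1 / 2)
    (hα : ∀ q : ℕ, 1 ≤ q → δ ≤ (q : ℝ) * nint (q * α)) (c C : ℝ) (hc : 0 < c) (hcδ : c ≤ δ / 4)
    (hC : ∀ n : ℕ, 1 ≤ n →
      ∑ q ∈ Finset.Ico ((2 : ℕ) ^ n) (2 ^ (64 * n)), epsq α c q ≤ c * C)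
    (hcC : 160 * (c * C) ≤ δ / 96) (hcδ2 : 896 * c / δ ≤ δ / 96)
    (K r Y W : ℕ) (hK : 1 ≤ K) (hY : Y = 2 ^ K) (p0 : ℤ) (hW : 1 ≤ W)
    (hbig : (2 : ℝ) ^ 180 * (W : ℝ) ^ 2 ≤ δ ^ 2 * Y)
    (hr1 : r ≤ Y ^ 128) (hr2 : δ * (Y : ℝ) ^ 128 ≤ r) (hp : |(r : ℝ) * α - p0| ≤ 1 / (Y : ℝ) ^ 128)
    (hcop : IsCoprime p0 (r : ℤ)) (hlog : (W : ℝ) ≤ 4 * (Real.log r) ^ 2) (hr : 1 ≤ r) (x0 : ℝ) :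
    ∑ q ∈ Finset.Ico (Y ^ 4) (Y ^ 256), volume ({x : ℝ | nint (q * x) ≤ 2 * epsq α c q} ∩
      {x : ℝ | nint (r * x) ≤ 1 / W} ∩ Set.Icc x0 (x0 + 1 / (Y : ℝ) ^ 4)) ≤
      ENNReal.ofReal (δ / 32 * (1 / W * (1 / (Y : ℝ) ^ 4))) := by
  classical
  set bad : ℕ → Prop := fun q => ∃ (v : ℕ) (u : ℤ), 1 ≤ v ∧ 1 ≤ q ∧ 1 ≤ u ∧ u ≤ (2 * W : ℕ) ∧
        |(v : ℤ) * q - u * r| < (Y ^ 4 : ℕ) ∧ v * q ≤ Y ^ 128 * W with hbad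
  set g : ℕ → ℝ := fun q => 160 * epsq α c q + (if bad q then 40 / (Y : ℝ) ^ 40 else 0) +
    (if r ∣ q then 448 * c / δ * (((q / r : ℕ) : ℝ) ^ 2)⁻¹ else 0) with hg
  have hW0 : (1 : ℝ) ≤ W := by exact_mod_cast hW
  have hYbig : (2 : ℝ) ^ 180 * (W : ℝ) ≤ δ * Y := by
    have h1 : (2 : ℝ) ^ 180 * (W : ℝ) ≤ 2 ^ 180 * (W : ℝ) ^ 2 := by
      apply mul_le_mul_of_nonneg_left _ (by positivity); nlinarith
    have h2 : δ ^ 2 * Y ≤ δ * Y := by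
      apply mul_le_mul_of_nonneg_right _ (by positivity); nlinarith
    linarith
  have hYW : (2 : ℝ) ^ 180 * (W : ℝ) ≤ Y := by
    have h0 : (0 : ℝ) ≤ Y := by positivity
    nlinarith
  have hY1 : 1 ≤ Y := by rw [hY]; exact Nat.one_le_two_pow
  have hY1r : (1 : ℝ) ≤ Y := by exact_mod_cast hY1
  have hg0 : ∀ q, 0 ≤ g q := by
    intro q
    have := epsq_nonneg α c hc.le q
    simp only [hg]
    split_ifs <;> positivity
  have hper : ∀ q ∈ Finset.Ico (Y ^ 4) (Y ^ 256),
      volume ({x : ℝ | nint (q * x) ≤ 2 * epsq α c q} ∩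
      {x : ℝ | nint (r * x) ≤ 1 / W} ∩ Set.Icc x0 (x0 + 1 / (Y : ℝ) ^ 4)) ≤
      ENNReal.ofReal (g q * (1 / W * (1 / (Y : ℝ) ^ 4))) := by
    intro q hq
    rw [Finset.mem_Ico] at hq
    have he := epsq_nonneg α c hc.le q
    have a1 : 0 ≤ (if bad q then 40 / (Y : ℝ) ^ 40 else 0) := by split_ifs <;> positivity
    have a2 : 0 ≤ (if r ∣ q then 448 * c / δ * (((q / r : ℕ) : ℝ) ^ 2)⁻¹ else 0) := by
      split_ifs <;> positivity
    rcases KE_q hδ hδ1 hα c hc hcδ q r Y W p0 hW hbig hr1 hr2 hp hcop hlog hr hq.1 x0 _ rfl with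
      h | ⟨h1, h⟩ | ⟨m, hm1, hm, h⟩
    · refine h.trans (ENNReal.ofReal_le_ofReal ?_)
      gcongr
      simp only [hg]; linarith
    · refine h.trans (ENNReal.ofReal_le_ofReal ?_)
      gcongr
      simp only [hg]
      rw [if_pos (show bad q from h1)]; linarith
    · refine h.trans (ENNReal.ofReal_le_ofReal ?_)
      gcongr
      simp only [hg]
      rw [if_pos (show r ∣ q from ⟨m, by rw [hm, mul_comm]⟩)]
      have : q / r = m := by rw [hm]; exact Nat.mul_div_cancel _ hr
      rw [this]
      have : 448 * c / (m ^ 2 * δ) = 448 * c / δ * ((m : ℝ) ^ 2)⁻¹ := by field_simp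
      rw [this]; linarith
  refine (Finset.sum_le_sum hper).trans ?_
  rw [← ENNReal.ofReal_sum_of_nonneg (fun q _ => by have := hg0 q; positivity), ← Finset.sum_mul]
  apply ENNReal.ofReal_le_ofReal
  gcongr
  simp only [hg]
  rw [Finset.sum_add_distrib, Finset.sum_add_distrib, ← Finset.mul_sum]
  have s1 : ∑ q ∈ Finset.Ico (Y ^ 4) (Y ^ 256), epsq α c q ≤ c * C := by
    have := hC (4 * K) (by omega)
    have e1 : Y ^ 4 = 2 ^ (4 * K) := by rw [hY, ← pow_mul, mul_comm]
    have e2 : Y ^ 256 = 2 ^ (64 * (4 * K)) := by rw [hY, ← pow_mul]; congr 1; ring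
    rw [e1, e2]; exact this
  have s3 : ∑ q ∈ Finset.Ico (Y ^ 4) (Y ^ 256),
      (if r ∣ q then 448 * c / δ * (((q / r : ℕ) : ℝ) ^ 2)⁻¹ else 0) ≤ 896 * c / δ := by
    rw [← Finset.sum_filter]
    refine (sum_dvd_le r _ _ hr (448 * c / δ) (by positivity) (Nat.one_le_pow _ _ hY1)).trans
      (le_of_eq ?_)
    ring
  have s2 : ∑ q ∈ Finset.Ico (Y ^ 4) (Y ^ 256), (if bad q then 40 / (Y : ℝ) ^ 40 else 0) ≤ δ / 96 := by
    rw [← Finset.sum_filter, Finset.sum_const, nsmul_eq_mul]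
    have hcard : ((Finset.Ico (Y ^ 4) (Y ^ 256)).filter bad).card ≤ (2 * W) * (2 * Y ^ 4) * Y ^ 34 := by
      apply bad_count 0 r (2 * W) (Y ^ 4) (Y ^ 34) (Y ^ 128 * W)
      · intro n hn1 hn
        have h4 := card_divisors_pow_four n (by omega)
        by_contra hcon
        push Not at hcon
        have h5 : (Y ^ 34) ^ 4 < n.divisors.card ^ 4 := Nat.pow_lt_pow_left hcon (by norm_num)
        have h6 : 256 ^ 16 * W ≤ Y ^ 8 := by
          have : (256 : ℝ) ^ 16 * W ≤ (Y : ℝ) ^ 8 := by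
            have t1 : (256 : ℝ) ^ 16 * (W : ℝ) ≤ (2 : ℝ) ^ 180 * (W : ℝ) := by
              gcongr; norm_num
            have t2 : (Y : ℝ) ≤ (Y : ℝ) ^ 8 := le_self_pow₀ hY1r (by norm_num)
            linarith
          exact_mod_cast this
        have h7 : 256 ^ 16 * n ≤ (Y ^ 34) ^ 4 := by
          calc 256 ^ 16 * n ≤ 256 ^ 16 * (Y ^ 128 * W) := by gcongr
            _ = (256 ^ 16 * W) * Y ^ 128 := by ring
            _ ≤ Y ^ 8 * Y ^ 128 := by gcongr
            _ = _ := by ring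
        omega
      · intro q hq
        exact (Finset.mem_filter.1 hq).2
    calc (((Finset.Ico (Y ^ 4) (Y ^ 256)).filter bad).card : ℝ) * (40 / (Y : ℝ) ^ 40)
        ≤ (((2 * W) * (2 * Y ^ 4) * Y ^ 34 : ℕ) : ℝ) * (40 / (Y : ℝ) ^ 40) := by
          gcongr
      _ = 160 * W / (Y : ℝ) ^ 2 := by push_cast; field_simp; ring
      _ ≤ 160 * W / Y := by
          gcongr
          exact le_self_pow₀ hY1r (by norm_num)
      _ ≤ δ / 96 := by
          rw [div_le_div_iff₀ (by positivity) (by norm_num)]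
          refine le_trans ?_ hYbig
          nlinarith
  linarith

theorem nint_continuous : Continuous nint := by
  have : LipschitzWith 1 nint := by
    apply LipschitzWith.of_le_add
    intro x y
    rw [Real.dist_eq]
    exact nint_lip x y
  exact this.continuous

theorem meas_nint_le (q : ℕ) (e : ℝ) : MeasurableSet {x : ℝ | nint (q * x) ≤ e} := by
  apply IsClosed.measurableSet
  exact isClosed_le (nint_continuous.comp (by fun_prop)) continuous_const

open MeasureTheory in
theorem cells_count (M : ℝ) (hM : 0 < M) (F : Finset ℕ) (E Z : Set ℝ) (hE : MeasurableSet E)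
    (θ : ℝ) (hθ0 : 0 ≤ θ) (hZ : ∀ i ∈ F, Set.Ico ((i : ℝ) / M) ((i + 1) / M) ⊆ Z)
    (hθ : ∀ i ∈ F, ENNReal.ofReal (θ / M) ≤ volume (Set.Ico ((i : ℝ) / M) ((i + 1) / M) ∩ E)) :
    ENNReal.ofReal (F.card * (θ / M)) ≤ volume (Z ∩ E) := by
  have h1 : volume (⋃ i ∈ F, Set.Ico ((i : ℝ) / M) ((i + 1) / M) ∩ E) =
      ∑ i ∈ F, volume (Set.Ico ((i : ℝ) / M) ((i + 1) / M) ∩ E) := by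
    apply measure_biUnion_finset
    · intro i _ k _ hik
      rw [Function.onFun, Set.disjoint_left]
      rintro x ⟨⟨a1, a2⟩, _⟩ ⟨⟨b1, b2⟩, _⟩
      rw [div_le_iff₀ hM] at a1 b1
      rw [lt_div_iff₀ hM] at a2 b2
      have c1 : (i : ℝ) < k + 1 := by linarith
      have c2 : (k : ℝ) < i + 1 := by linarith
      have c3 : i < k + 1 := by exact_mod_cast c1
      have c4 : k < i + 1 := by exact_mod_cast c2
      omega
    · intro i _
      exact measurableSet_Ico.inter hE
  calc ENNReal.ofReal (F.card * (θ / M)) = ∑ i ∈ F, ENNReal.ofReal (θ / M) := by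
        rw [Finset.sum_const, nsmul_eq_mul, ENNReal.ofReal_mul (by positivity)]
        simp
    _ ≤ ∑ i ∈ F, volume (Set.Ico ((i : ℝ) / M) ((i + 1) / M) ∩ E) := Finset.sum_le_sum hθ
    _ = _ := h1.symm
    _ ≤ _ := by
        apply measure_mono
        intro x hx
        simp only [Set.mem_iUnion] at hx
        obtain ⟨i, hi, hx1, hx2⟩ := hx
        exact ⟨hZ i hi hx1, hx2⟩

theorem cand_count (Fr : Finset ℕ) (r T4 N S W : ℕ) (hr : 1 ≤ r) (hT4 : 1 ≤ T4) (hW : 1 ≤ W)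
    (hS : (S + 1) * r * W ≤ N) :
    ∃ Cn : Finset ℕ, (∀ J ∈ Cn, ∃ i ∈ Fr, ∃ p : ℕ, i * r ≤ p * T4 ∧ (p + 1) * T4 ≤ (i + 1) * r ∧
        p * N ≤ J * r ∧ (J + 1) * r * W ≤ p * N * W + N) ∧
      (Fr.card : ℝ) * ((r : ℝ) / T4 - 2) * S ≤ Cn.card := by
  classical
  set Pi : ℕ → Finset ℕ := fun i => Finset.Ico (i * r / T4 + 1) ((i + 1) * r / T4) with hPi
  set Dm := (Fr.sigma Pi) ×ˢ Finset.range S with hDm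
  set f : ((_ : ℕ) × ℕ) × ℕ → ℕ := fun z => z.1.2 * N / r + 1 + z.2 with hf
  have hP : ∀ i p, p ∈ Pi i → i * r ≤ p * T4 ∧ (p + 1) * T4 ≤ (i + 1) * r := by
    intro i p hp
    simp only [hPi, Finset.mem_Ico] at hp
    constructor
    · have := Nat.lt_mul_of_div_lt (show i * r / T4 < p by omega) hT4
      exact this.le
    · exact (Nat.le_div_iff_mul_le hT4).1 hp.2
  have hJ : ∀ p s : ℕ, s < S → p * N ≤ (p * N / r + 1 + s) * r ∧
      (p * N / r + 1 + s) * r + r ≤ p * N + (S + 1) * r := by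
    intro p s hs
    have h1 := Nat.lt_div_mul_add (a := p * N) (show 0 < r from hr)
    have h2 := Nat.div_mul_le_self (p * N) r
    have h3 : (s + 1) * r ≤ S * r := Nat.mul_le_mul_right r hs
    constructor <;> nlinarith
  have hSr : (S + 1) * r ≤ N := le_trans (Nat.le_mul_of_pos_right _ hW) hS
  refine ⟨Dm.image f, ?_, ?_⟩
  · intro J hJm
    rw [Finset.mem_image] at hJm
    obtain ⟨⟨⟨i, p⟩, s⟩, hz, rfl⟩ := hJm
    simp only [hDm, Finset.mem_product, Finset.mem_sigma, Finset.mem_range] at hz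
    obtain ⟨⟨hi, hp⟩, hs⟩ := hz
    obtain ⟨h1, h2⟩ := hP i p hp
    obtain ⟨h3, h4⟩ := hJ p s hs
    refine ⟨i, hi, p, h1, h2, h3, ?_⟩
    simp only [hf]
    calc (p * N / r + 1 + s + 1) * r * W = ((p * N / r + 1 + s) * r + r) * W := by ring
      _ ≤ (p * N + (S + 1) * r) * W := Nat.mul_le_mul_right _ h4
      _ = p * N * W + (S + 1) * r * W := by ring
      _ ≤ _ := by gcongr
  · rw [Finset.card_image_of_injOn, hDm, Finset.card_product, Finset.card_range, Finset.card_sigma]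
    · push_cast
      gcongr
      rw [← nsmul_eq_mul, ← Finset.sum_const]
      apply Finset.sum_le_sum
      intro i _
      simp only [hPi, Nat.card_Ico]
      have hT0 : (0 : ℝ) < T4 := by exact_mod_cast hT4
      have h1 : ((i * r / T4 : ℕ) : ℝ) ≤ ((i * r : ℕ) : ℝ) / T4 := Nat.cast_div_le
      have h2 : (((i + 1) * r : ℕ) : ℝ) / T4 < (((i + 1) * r / T4 : ℕ) : ℝ) + 1 := by
        rw [div_lt_iff₀ hT0]
        have := Nat.lt_div_mul_add (a := (i + 1) * r) (show 0 < T4 from hT4)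
        have h : (((i + 1) * r : ℕ) : ℝ) < (((i + 1) * r / T4 * T4 + T4 : ℕ) : ℝ) := by
          exact_mod_cast this
        push_cast at h ⊢
        linarith
      have h3 : (((i + 1) * r : ℕ) : ℝ) / T4 = ((i * r : ℕ) : ℝ) / T4 + r / T4 := by
        push_cast; ring
      have h4 : ((((i + 1) * r / T4 : ℕ)) : ℝ) ≤
          (((i + 1) * r / T4 - (i * r / T4 + 1) : ℕ) : ℝ) + ((i * r / T4 : ℕ) : ℝ) + 1 := by
        exact_mod_cast (by omega)
      linarith
    · rintro ⟨⟨i, p⟩, s⟩ hz ⟨⟨i', p'⟩, s'⟩ hz' heq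
      simp only [hDm, Finset.coe_product, Set.mem_prod, Finset.mem_coe, Finset.mem_sigma,
        Finset.mem_range] at hz hz'
      obtain ⟨⟨hi, hp⟩, hs⟩ := hz
      obtain ⟨⟨hi', hp'⟩, hs'⟩ := hz'
      simp only [hf] at heq
      obtain ⟨h1, h2⟩ := hP i p hp
      obtain ⟨h1', h2'⟩ := hP i' p' hp'
      obtain ⟨h3, h4⟩ := hJ p s hs
      obtain ⟨h3', h4'⟩ := hJ p' s' hs'
      have hN : 0 < N := lt_of_lt_of_le (by positivity) hSr
      have e1 : p = p' := by
        rw [heq] at h3 h4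
        have c1 : p * N < (p' + 1) * N := by nlinarith
        have c2 : p' * N < (p + 1) * N := by nlinarith
        have := Nat.lt_of_mul_lt_mul_right c1
        have := Nat.lt_of_mul_lt_mul_right c2
        omega
      subst e1
      have e2 : s = s' := by omega
      have e3 : i = i' := by
        have c1 : i * r < (i' + 1) * r := by nlinarith
        have c2 : i' * r < (i + 1) * r := by nlinarith
        have := Nat.lt_of_mul_lt_mul_right c1
        have := Nat.lt_of_mul_lt_mul_right c2
        omega
      subst e2 e3
      rfl

def Eset (α c : ℝ) (a b : ℕ) : Set ℝ :=
  ⋃ q ∈ Finset.Ico a b, {x : ℝ | nint (q * x) ≤ 2 * epsq α c q}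

theorem meas_Eset (α c : ℝ) (a b : ℕ) : MeasurableSet (Eset α c a b) :=
  Finset.measurableSet_biUnion _ (fun q _ => meas_nint_le q _)

theorem cell_sub (T n j i : ℕ) (hT : 1 ≤ T) (hi : j * T ^ n ≤ i) (hi2 : i < (j + 1) * T ^ n) :
    (j : ℝ) / T ≤ (i : ℝ) / (T : ℝ) ^ (n + 1) ∧
      ((i : ℝ) + 1) / (T : ℝ) ^ (n + 1) ≤ ((j : ℝ) + 1) / T := by
  have hT0 : (0 : ℝ) < T := by exact_mod_cast hT
  have h1 : (j : ℝ) * (T : ℝ) ^ n ≤ i := by exact_mod_cast hi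
  have h2 : (i : ℝ) + 1 ≤ (j + 1) * (T : ℝ) ^ n := by exact_mod_cast hi2
  constructor
  · rw [div_le_div_iff₀ hT0 (by positivity), pow_succ]; nlinarith
  · rw [div_le_div_iff₀ (by positivity) hT0, pow_succ]; nlinarith

open MeasureTheory in
theorem free_cells {α δ : ℝ} (hδ : 0 < δ) (hα : ∀ q : ℕ, 1 ≤ q → δ ≤ (q : ℝ) * nint (q * α))
    (c : ℝ) (T y j : ℕ) (hy : 2 ≤ y) (hT : 1 ≤ T)
    (hlogT : ∀ q : ℕ, 1 ≤ q → q < T → (Real.log q) ^ 2 ≤ T) (hc : 0 < c) (hcT : 1 ≤ c * T)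
    (hgood : volume (Set.Ico ((j : ℝ) / T) ((j + 1) / T) ∩ Eset α c y T) ≤
      ENNReal.ofReal (1 / 2 / T)) :
    ∃ Fr : Finset ℕ, Fr ⊆ Finset.Ico (j * T ^ 3) ((j + 1) * T ^ 3) ∧
      (T : ℝ) ^ 3 / 2 ≤ Fr.card ∧
      ∀ i ∈ Fr, ∀ x ∈ Set.Icc ((i : ℝ) / (T : ℝ) ^ 4) ((i + 1) / (T : ℝ) ^ 4),
        ∀ q ∈ Finset.Ico y T, epsq α c q ≤ nint (q * x) := by
  classical
  have hT0 : (0 : ℝ) < T := by exact_mod_cast hT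
  set pr : ℕ → Prop := fun i => ∀ x ∈ Set.Icc ((i : ℝ) / (T : ℝ) ^ 4) ((i + 1) / (T : ℝ) ^ 4),
        ∀ q ∈ Finset.Ico y T, epsq α c q ≤ nint (q * x) with hpr
  set B := Finset.Ico (j * T ^ 3) ((j + 1) * T ^ 3) with hB
  refine ⟨B.filter pr, Finset.filter_subset _ _, ?_, fun i hi => (Finset.mem_filter.1 hi).2⟩
  have hcells := cells_count ((T : ℝ) ^ 4) (by positivity) (B.filter (fun i => ¬ pr i))
    (Eset α c y T) (Set.Ico ((j : ℝ) / T) ((j + 1) / T)) (meas_Eset _ _ _ _) 1 zero_le_one ?_ ?_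
  · have h1 := hcells.trans hgood
    rw [ENNReal.ofReal_le_ofReal_iff (by positivity), mul_one_div, div_le_iff₀ (by positivity)] at h1
    have h2 : 1 / 2 / (T : ℝ) * (T : ℝ) ^ 4 = (T : ℝ) ^ 3 / 2 := by field_simp
    rw [h2] at h1
    have h3 := Finset.card_filter_add_card_filter_not (s := B) pr
    have h4 : B.card = T ^ 3 := by
      rw [hB, Nat.card_Ico, add_mul, one_mul]; omega
    have h5 : ((B.filter pr).card : ℝ) + ((B.filter (fun i => ¬ pr i)).card : ℝ) = (T : ℝ) ^ 3 := by
      rw [h4] at h3; exact_mod_cast h3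
    linarith
  · intro i hi x hx
    rw [Finset.mem_filter, hB, Finset.mem_Ico] at hi
    obtain ⟨a1, a2⟩ := cell_sub T 3 j i hT hi.1.1 hi.1.2
    exact ⟨a1.trans hx.1, hx.2.trans_le a2⟩
  · intro i hi
    rw [Finset.mem_filter] at hi
    have hn := hi.2
    simp only [hpr] at hn
    push Not at hn
    obtain ⟨x, hx, q, hq, hlt⟩ := hn
    have hq' := Finset.mem_Ico.1 hq
    have hqT : (q : ℝ) ≤ T := by exact_mod_cast hq'.2.le
    have hq1 : 1 ≤ q := by omega
    have hq0 : (0 : ℝ) < q := by exact_mod_cast hq1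
    have hlq : 0 < Real.log q := Real.log_pos (by exact_mod_cast (by omega : 1 < q))
    have hnp := nint_pos hδ hα q hq1
    have heps : 1 / (T : ℝ) ^ 3 ≤ epsq α c q := by
      have hden : (q : ℝ) * (Real.log q) ^ 2 * nint (q * α) ≤ (T : ℝ) ^ 2 := by
        calc (q : ℝ) * (Real.log q) ^ 2 * nint (q * α) ≤ T * T * 1 := by
              gcongr
              · exact hlogT q hq1 hq'.2
              · exact (nint_le_half _).trans (by norm_num)
          _ = _ := by ring
      unfold epsq
      rw [div_le_div_iff₀ (by positivity) (by positivity)]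
      calc 1 * ((q : ℝ) * (Real.log q) ^ 2 * nint (q * α)) ≤ (T : ℝ) ^ 2 := by rw [one_mul]; exact hden
        _ ≤ (c * T) * (T : ℝ) ^ 2 := le_mul_of_one_le_left (by positivity) hcT
        _ = _ := by ring
    have hsub : Set.Ico ((i : ℝ) / (T : ℝ) ^ 4) ((i + 1) / (T : ℝ) ^ 4) ⊆ Eset α c y T := by
      intro z hz
      simp only [Eset, Set.mem_iUnion]
      refine ⟨q, hq, ?_⟩
      show nint (q * z) ≤ 2 * epsq α c q
      have h1 := nint_lip (q * z) (q * x)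
      have h2 : |(q : ℝ) * z - q * x| ≤ 1 / (T : ℝ) ^ 3 := by
        rw [← mul_sub, abs_mul, abs_of_pos hq0]
        have h3 : |z - x| ≤ 1 / (T : ℝ) ^ 4 := by
          rw [abs_le]
          have e : ((i : ℝ) + 1) / (T : ℝ) ^ 4 = i / (T : ℝ) ^ 4 + 1 / (T : ℝ) ^ 4 := by ring
          constructor <;> linarith [hz.1, hz.2, hx.1, hx.2]
        calc (q : ℝ) * |z - x| ≤ T * (1 / (T : ℝ) ^ 4) := by gcongr
          _ = _ := by field_simp
      linarith
    rw [Set.inter_eq_left.2 hsub, Real.volume_Ico]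
    apply ENNReal.ofReal_le_ofReal
    apply le_of_eq; ring

set_option maxHeartbeats 1000000 in
open MeasureTheory in
theorem step0 {α δ : ℝ} (hδ : 0 < δ) (hδ1 : δ ≤ 1 / 2)
    (hα : ∀ q : ℕ, 1 ≤ q → δ ≤ (q : ℝ) * nint (q * α)) (c C : ℝ) (hc : 0 < c) (hcδ : c ≤ δ / 4)
    (hC : ∀ n : ℕ, 1 ≤ n →
      ∑ q ∈ Finset.Ico ((2 : ℕ) ^ n) (2 ^ (64 * n)), epsq α c q ≤ c * C)
    (hcC : 160 * (c * C) ≤ δ / 96) (hcδ2 : 896 * c / δ ≤ δ / 96)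
    (K r Y W T y S j : ℕ) (hK : 1 ≤ K) (hY : Y = 2 ^ K) (p0 : ℤ) (hW : 1 ≤ W)
    (hbig : (2 : ℝ) ^ 180 * (W : ℝ) ^ 2 ≤ δ ^ 2 * Y)
    (hr1 : r ≤ Y ^ 128) (hr2 : δ * (Y : ℝ) ^ 128 ≤ r) (hp : |(r : ℝ) * α - p0| ≤ 1 / (Y : ℝ) ^ 128)
    (hcop : IsCoprime p0 (r : ℤ)) (hlog : (W : ℝ) ≤ 4 * (Real.log r) ^ 2) (hr : 1 ≤ r)
    (hTY : T = Y ^ 4) (hSW : T ^ 32 = 2 * W * S) (hS : 1 ≤ S) (hy : 2 ≤ y) (hT : 1 ≤ T)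
    (hlogT : ∀ q : ℕ, 1 ≤ q → q < T → (Real.log q) ^ 2 ≤ T) (hcT : 1 ≤ c * T)
    (hδT : 4 ≤ δ * T)
    (hgood : volume (Set.Ico ((j : ℝ) / T) ((j + 1) / T) ∩ Eset α c y T) ≤
      ENNReal.ofReal (1 / 2 / T)) :
    ∃ Ch : Finset ℕ, Ch ⊆ Finset.Ico (j * T ^ 63) ((j + 1) * T ^ 63) ∧
      δ * (T : ℝ) ^ 63 / (16 * W) ≤ Ch.card ∧
      ∀ J ∈ Ch, volume (Set.Ico ((J : ℝ) / (T : ℝ) ^ 64) ((J + 1) / (T : ℝ) ^ 64) ∩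
          Eset α c T (T ^ 64)) ≤ ENNReal.ofReal (1 / 2 / (T : ℝ) ^ 64) ∧
        ∀ x ∈ Set.Icc ((J : ℝ) / (T : ℝ) ^ 64) ((J + 1) / (T : ℝ) ^ 64),
          (∀ q ∈ Finset.Ico y T, epsq α c q ≤ nint (q * x)) ∧ nint (r * x) ≤ 1 / W := by
  classical
  have hT0 : (0 : ℝ) < T := by exact_mod_cast hT
  have hT1 : (1 : ℝ) ≤ T := by exact_mod_cast hT
  have hr0 : (0 : ℝ) < r := by exact_mod_cast hr
  have hW0 : (1 : ℝ) ≤ W := by exact_mod_cast hW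
  have hYT : (Y : ℝ) ^ 128 = (T : ℝ) ^ 32 := by rw [hTY]; push_cast; ring
  have hYT' : Y ^ 128 = T ^ 32 := by rw [hTY]; ring
  have hY4 : (Y : ℝ) ^ 4 = T := by rw [hTY]; push_cast; ring
  obtain ⟨Fr, hFr1, hFr2, hFr3⟩ := free_cells hδ hα c T y j hy hT hlogT hc hcT hgood
  have hSN : (S + 1) * r * W ≤ T ^ 64 := by
    calc (S + 1) * r * W ≤ (S + S) * T ^ 32 * W := by
          rw [hYT'] at hr1; gcongr
      _ = (2 * W * S) * T ^ 32 := by ring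
      _ = T ^ 64 := by rw [← hSW]; ring
  obtain ⟨Cn, hCn1, hCn2⟩ := cand_count Fr r (T ^ 4) (T ^ 64) S W hr (Nat.one_le_pow _ _ hT) hW hSN
  have hprop : ∀ J ∈ Cn, J ∈ Finset.Ico (j * T ^ 63) ((j + 1) * T ^ 63) ∧
      ∀ x ∈ Set.Icc ((J : ℝ) / (T : ℝ) ^ 64) ((J + 1) / (T : ℝ) ^ 64),
          (∀ q ∈ Finset.Ico y T, epsq α c q ≤ nint (q * x)) ∧ nint (r * x) ≤ 1 / W := by
    intro J hJ
    obtain ⟨i, hi, p, h1, h2, h3, h4⟩ := hCn1 J hJ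
    have hi' := Finset.mem_Ico.1 (hFr1 hi)
    have h1r : (i : ℝ) * r ≤ p * (T : ℝ) ^ 4 := by exact_mod_cast h1
    have h2r : ((p : ℝ) + 1) * (T : ℝ) ^ 4 ≤ (i + 1) * r := by exact_mod_cast h2
    have h3r : (p : ℝ) * (T : ℝ) ^ 64 ≤ J * r := by exact_mod_cast h3
    have h4r : ((J : ℝ) + 1) * r * W ≤ p * (T : ℝ) ^ 64 * W + (T : ℝ) ^ 64 := by exact_mod_cast h4
    have b1 : (i : ℝ) / (T : ℝ) ^ 4 ≤ p / r := by
      rw [div_le_div_iff₀ (by positivity) hr0]; linarith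
    have b2 : (p : ℝ) / r ≤ J / (T : ℝ) ^ 64 := by
      rw [div_le_div_iff₀ hr0 (by positivity)]; linarith
    have b3 : ((J : ℝ) + 1) / (T : ℝ) ^ 64 ≤ p / r + 1 / (r * W) := by
      have : (p : ℝ) / r + 1 / (r * W) = (p * W + 1) / (r * W) := by field_simp
      rw [this, div_le_div_iff₀ (by positivity) (by positivity)]
      nlinarith
    have b4 : (p : ℝ) / r + 1 / (r * W) ≤ (p + 1) / r := by
      have : 1 / ((r : ℝ) * W) ≤ 1 / r := by
        apply one_div_le_one_div_of_le hr0
        nlinarith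
      have e : ((p : ℝ) + 1) / r = p / r + 1 / r := by ring
      linarith
    have b5 : ((p : ℝ) + 1) / r ≤ (i + 1) / (T : ℝ) ^ 4 := by
      rw [div_le_div_iff₀ hr0 (by positivity)]; linarith
    obtain ⟨a1, a2⟩ := cell_sub T 3 j i hT hi'.1 hi'.2
    refine ⟨?_, ?_⟩
    · rw [Finset.mem_Ico]
      have c1 : (j : ℝ) / T ≤ J / (T : ℝ) ^ 64 := by linarith
      have c2 : ((J : ℝ) + 1) / (T : ℝ) ^ 64 ≤ (j + 1) / T := by linarith
      rw [div_le_div_iff₀ hT0 (by positivity)] at c1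
      rw [div_le_div_iff₀ (by positivity) hT0] at c2
      have d1 : (j : ℝ) * (T : ℝ) ^ 63 ≤ J := by
        apply le_of_mul_le_mul_right _ hT0
        calc (j : ℝ) * (T : ℝ) ^ 63 * T = j * (T : ℝ) ^ 64 := by ring
          _ ≤ _ := c1
      have d2 : (J : ℝ) + 1 ≤ (j + 1) * (T : ℝ) ^ 63 := by
        apply le_of_mul_le_mul_right _ hT0
        calc ((J : ℝ) + 1) * T ≤ _ := c2
          _ = _ := by ring
      exact ⟨by exact_mod_cast d1, by exact_mod_cast d2⟩
    · intro x hx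
      refine ⟨hFr3 i hi x ⟨by linarith [hx.1], by linarith [hx.2]⟩, ?_⟩
      refine (nint_le (r * x) p).trans ?_
      push_cast
      have e1 : (p : ℝ) / r ≤ x := by linarith [hx.1]
      have e2 : x ≤ p / r + 1 / (r * W) := by linarith [hx.2]
      rw [div_le_iff₀ hr0] at e1
      have e3 : r * x ≤ p + 1 / W := by
        have := mul_le_mul_of_nonneg_left e2 hr0.le
        have e : (r : ℝ) * (p / r + 1 / (r * W)) = p + 1 / W := by field_simp
        linarith
      rw [abs_of_nonneg (by linarith)]
      linarith
  set gd : ℕ → Prop := fun J => volume (Set.Ico ((J : ℝ) / (T : ℝ) ^ 64) ((J + 1) / (T : ℝ) ^ 64) ∩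
          Eset α c T (T ^ 64)) ≤ ENNReal.ofReal (1 / 2 / (T : ℝ) ^ 64) with hgd
  refine ⟨Cn.filter gd, ?_, ?_, ?_⟩
  · exact (Finset.filter_subset _ _).trans (fun J hJ => (hprop J hJ).1)
  · have hKE := KE hδ hδ1 hα c C hc hcδ hC hcC hcδ2 K r Y W hK hY p0 hW hbig hr1 hr2 hp hcop hlog hr
      ((j : ℝ) / T)
    have hcells := cells_count ((T : ℝ) ^ 64) (by positivity) (Cn.filter (fun J => ¬ gd J))
      (Eset α c T (T ^ 64)) ({x : ℝ | nint (r * x) ≤ 1 / W} ∩ Set.Icc ((j : ℝ) / T) ((j : ℝ) / T + 1 / T))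
      (meas_Eset _ _ _ _) (1 / 2) (by norm_num) ?_ ?_
    · have hle : volume (({x : ℝ | nint (r * x) ≤ 1 / W} ∩
          Set.Icc ((j : ℝ) / T) ((j : ℝ) / T + 1 / T)) ∩ Eset α c T (T ^ 64)) ≤
          ENNReal.ofReal (δ / 32 * (1 / W * (1 / T))) := by
        have e256 : Y ^ 256 = T ^ 64 := by rw [hTY]; ring
        rw [hY4, e256, ← hTY] at hKE
        refine le_trans ?_ hKE
        refine le_trans (measure_mono ?_) (measure_biUnion_finset_le _ _)
        rintro x ⟨⟨h1, h2⟩, h3⟩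
        simp only [Eset, Set.mem_iUnion] at h3 ⊢
        obtain ⟨q, hq, h4⟩ := h3
        exact ⟨q, hq, ⟨h4, h1⟩, h2⟩
      have h1 := hcells.trans hle
      rw [ENNReal.ofReal_le_ofReal_iff (by positivity)] at h1
      have h2 : ((Cn.filter (fun J => ¬ gd J)).card : ℝ) ≤ δ * (T : ℝ) ^ 63 / (16 * W) := by
        have e : δ * (T : ℝ) ^ 63 / (16 * W) = (δ / 32 * (1 / W * (1 / T))) * (2 * (T : ℝ) ^ 64) := by
          field_simp; norm_num
        rw [e]
        calc ((Cn.filter (fun J => ¬ gd J)).card : ℝ) =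
            ((Cn.filter (fun J => ¬ gd J)).card * (1 / 2 / (T : ℝ) ^ 64)) * (2 * (T : ℝ) ^ 64) := by
              field_simp
          _ ≤ _ := by gcongr
      have h3 := Finset.card_filter_add_card_filter_not (s := Cn) gd
      have h5 : ((Cn.filter gd).card : ℝ) + ((Cn.filter (fun i => ¬ gd i)).card : ℝ) = Cn.card := by
        exact_mod_cast h3
      have h6 : δ * (T : ℝ) ^ 63 / (8 * W) ≤ Cn.card := by
        refine le_trans ?_ hCn2
        have hSr : (S : ℝ) = (T : ℝ) ^ 32 / (2 * W) := by
          have : (T : ℝ) ^ 32 = 2 * W * S := by exact_mod_cast hSW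
          rw [this]; field_simp
        have hr3 : δ * (T : ℝ) ^ 28 / 2 ≤ (r : ℝ) / ((T ^ 4 : ℕ) : ℝ) - 2 := by
          rw [hYT] at hr2
          have k1 : δ * (T : ℝ) ^ 28 ≤ (r : ℝ) / ((T ^ 4 : ℕ) : ℝ) := by
            push_cast
            rw [le_div_iff₀ (by positivity)]
            calc δ * (T : ℝ) ^ 28 * (T : ℝ) ^ 4 = δ * (T : ℝ) ^ 32 := by ring
              _ ≤ _ := hr2
          have k2 : 4 ≤ δ * (T : ℝ) ^ 28 := by
            refine hδT.trans ?_
            gcongr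
            exact le_self_pow₀ hT1 (by norm_num)
          linarith
        calc δ * (T : ℝ) ^ 63 / (8 * W) = ((T : ℝ) ^ 3 / 2) * (δ * (T : ℝ) ^ 28 / 2) *
              ((T : ℝ) ^ 32 / (2 * W)) := by field_simp; norm_num
          _ ≤ _ := by rw [hSr]; gcongr
      have e : δ * (T : ℝ) ^ 63 / (8 * W) = δ * (T : ℝ) ^ 63 / (16 * W) + δ * (T : ℝ) ^ 63 / (16 * W) := by
        field_simp; norm_num
      linarith
    · intro J hJ x hx
      rw [Finset.mem_filter] at hJ
      obtain ⟨k1, k2⟩ := hprop J hJ.1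
      rw [Finset.mem_Ico] at k1
      obtain ⟨a1, a2⟩ := cell_sub T 63 j J hT k1.1 k1.2
      refine ⟨(k2 x ⟨hx.1, hx.2.le⟩).2, by linarith [hx.1], ?_⟩
      have e : ((j : ℝ) + 1) / T = j / T + 1 / T := by ring
      linarith [hx.2]
    · intro J hJ
      rw [Finset.mem_filter] at hJ
      exact (not_le.1 hJ.2).le
  · intro J hJ
    rw [Finset.mem_filter] at hJ
    exact ⟨hJ.2, (hprop J hJ.1).2⟩

open MeasureTheory in
def GoodN (α c : ℝ) (g j : ℕ) : Prop :=
  volume (Set.Ico ((j : ℝ) / (2 : ℝ) ^ (64 * 2 ^ g)) (((j : ℝ) + 1) / (2 : ℝ) ^ (64 * 2 ^ g)) ∩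
    Eset α c (2 ^ (2 ^ g)) (2 ^ (64 * 2 ^ g))) ≤ ENNReal.ofReal (1 / 2 / (2 : ℝ) ^ (64 * 2 ^ g))

def Pr (α c : ℝ) (g : ℕ) (x : ℝ) : Prop :=
  (∀ q ∈ Finset.Ico (2 ^ (2 ^ g)) (2 ^ (64 * 2 ^ g)), epsq α c q ≤ nint (q * x)) ∧
  ∃ r : ℕ, 2 ^ g ≤ r ∧ (r : ℝ) * (Real.log r) ^ 2 * nint (r * α) * nint (r * x) ≤ 1

theorem dirichlet_r {α δ : ℝ} 
    (hα : ∀ q : ℕ, 1 ≤ q → δ ≤ (q : ℝ) * nint (q * α)) (n : ℕ) (hn : 1 ≤ n) :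
    ∃ (r : ℕ) (p0 : ℤ), 1 ≤ r ∧ r ≤ n ∧ δ * n ≤ r ∧ |(r : ℝ) * α - p0| ≤ 1 / n ∧
      IsCoprime p0 (r : ℤ) ∧ (r : ℝ) * nint (r * α) ≤ 1 := by
  obtain ⟨w, hw1, hw2⟩ := Real.exists_rat_abs_sub_le_and_den_le α (n := n) hn
  have hd0 : (0 : ℝ) < w.den := by exact_mod_cast w.den_pos
  have hn0 : (0 : ℝ) < n := by exact_mod_cast hn
  have hwe : (w : ℝ) = w.num / w.den := by exact_mod_cast (Rat.num_div_den w).symm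
  have hkey : |(w.den : ℝ) * α - w.num| ≤ 1 / n := by
    have : (w.den : ℝ) * α - w.num = w.den * (α - w) := by
      rw [hwe]; field_simp
    rw [this, abs_mul, abs_of_pos hd0]
    calc _ ≤ (w.den : ℝ) * (1 / (((n : ℝ) + 1) * w.den)) := by gcongr
      _ = 1 / ((n : ℝ) + 1) := by field_simp
      _ ≤ _ := by gcongr; linarith
  have hni : nint (w.den * α) ≤ 1 / n := (nint_le _ _).trans hkey
  have hwn : (w.den : ℝ) ≤ n := by exact_mod_cast hw2
  have h1 : (w.den : ℝ) * nint (w.den * α) ≤ w.den * (1 / n) := by gcongr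
  refine ⟨w.den, w.num, w.den_pos, hw2, ?_, hkey, Rat.isCoprime_num_den w, ?_⟩
  · have := hα w.den w.den_pos
    have h2 : δ ≤ w.den * (1 / n) := this.trans h1
    rw [mul_one_div, le_div_iff₀ hn0] at h2
    exact h2
  · refine h1.trans ?_
    rw [mul_one_div, div_le_one hn0]; exact hwn

open MeasureTheory in
theorem initial {α δ : ℝ} (hδ : 0 < δ)
    (hα : ∀ q : ℕ, 1 ≤ q → δ ≤ (q : ℝ) * nint (q * α)) (c C : ℝ) (hc : 0 < c) (hcδ : c ≤ δ / 4)
    (hC : ∀ n : ℕ, 1 ≤ n →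
      ∑ q ∈ Finset.Ico ((2 : ℕ) ^ n) (2 ^ (64 * n)), epsq α c q ≤ c * C)
    (hcC : 160 * (c * C) ≤ δ / 96) (hδ1 : δ ≤ 1 / 2) (g : ℕ) : ∃ j, GoodN α c g j := by
  by_contra hno
  push Not at hno
  have hcells := cells_count ((2 : ℝ) ^ (64 * 2 ^ g)) (by positivity) (Finset.range (2 ^ (64 * 2 ^ g)))
    (Eset α c (2 ^ (2 ^ g)) (2 ^ (64 * 2 ^ g))) (Set.Icc 0 (0 + 1)) (meas_Eset _ _ _ _) (1 / 2)
    (by norm_num) ?_ ?_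
  · have hsum : volume (Set.Icc (0 : ℝ) (0 + 1) ∩ Eset α c (2 ^ (2 ^ g)) (2 ^ (64 * 2 ^ g))) ≤
        ENNReal.ofReal (112 * (c * C)) := by
      have h1 : volume (Set.Icc (0 : ℝ) (0 + 1) ∩ Eset α c (2 ^ (2 ^ g)) (2 ^ (64 * 2 ^ g))) ≤
          ∑ q ∈ Finset.Ico ((2 : ℕ) ^ (2 ^ g)) (2 ^ (64 * 2 ^ g)),
            volume ({x : ℝ | nint (q * x) ≤ 2 * epsq α c q} ∩ Set.Icc (0 : ℝ) (0 + 1)) := by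
        refine le_trans (measure_mono ?_) (measure_biUnion_finset_le _ _)
        rintro x ⟨h2, h3⟩
        simp only [Eset, Set.mem_iUnion] at h3 ⊢
        obtain ⟨q, hq, h4⟩ := h3
        exact ⟨q, hq, h4, h2⟩
      refine h1.trans ?_
      have h2 : ∀ q ∈ Finset.Ico ((2 : ℕ) ^ (2 ^ g)) (2 ^ (64 * 2 ^ g)),
          volume ({x : ℝ | nint (q * x) ≤ 2 * epsq α c q} ∩ Set.Icc (0 : ℝ) (0 + 1)) ≤
            ENNReal.ofReal (112 * epsq α c q) := by
        intro q hq
        rw [Finset.mem_Ico] at hq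
        have hq2 : 2 ≤ q := by
          refine le_trans ?_ hq.1
          calc 2 = 2 ^ 1 := by norm_num
            _ ≤ 2 ^ (2 ^ g) := Nat.pow_le_pow_right (by norm_num) Nat.one_le_two_pow
        have hq2r : (2 : ℝ) ≤ q := by exact_mod_cast hq2
        have he0 := epsq_nonneg α c hc.le q
        have he := epsq_le hδ hα c hc.le q hq2
        have : 4 * c / δ ≤ 1 := by rw [div_le_one hδ]; linarith
        refine (vol_triv q (by omega) (2 * epsq α c q) 1 0 (by positivity) (by linarith)
          zero_le_one (by linarith)).trans (ENNReal.ofReal_le_ofReal (le_of_eq ?_))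
        ring
      refine (Finset.sum_le_sum h2).trans ?_
      rw [← ENNReal.ofReal_sum_of_nonneg
        (fun q _ => by have := epsq_nonneg α c hc.le q; positivity), ← Finset.mul_sum]
      apply ENNReal.ofReal_le_ofReal
      have := hC (2 ^ g) Nat.one_le_two_pow
      linarith
    have h := hcells.trans hsum
    have e0 : 0 ≤ c * C := by
      refine le_trans (Finset.sum_nonneg (fun q _ => epsq_nonneg α c hc.le q)) (hC 1 le_rfl)
    rw [ENNReal.ofReal_le_ofReal_iff (by positivity), Finset.card_range] at h
    have e : ((2 ^ (64 * 2 ^ g) : ℕ) : ℝ) * (1 / 2 / (2 : ℝ) ^ (64 * 2 ^ g)) = 1 / 2 := by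
      push_cast; field_simp
    rw [e] at h
    linarith
  · intro i hi x hx
    rw [Finset.mem_range] at hi
    have hi' : (i : ℝ) + 1 ≤ (2 : ℝ) ^ (64 * 2 ^ g) := by exact_mod_cast hi
    refine ⟨le_trans (by positivity) hx.1, ?_⟩
    refine hx.2.le.trans ?_
    rw [div_le_iff₀ (by positivity)]; linarith
  · intro i _
    have := hno i
    unfold GoodN at this
    exact (not_le.1 this).le

theorem lg_lt (g : ℕ) : g + 1 ≤ 2 ^ g := Nat.lt_two_pow_self

set_option maxHeartbeats 1000000 in
theorem step1 {α δ : ℝ} (hδ : 0 < δ) (hδ1 : δ ≤ 1 / 2)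
    (hα : ∀ q : ℕ, 1 ≤ q → δ ≤ (q : ℝ) * nint (q * α)) (c C : ℝ) (hc : 0 < c) (hcδ : c ≤ δ / 4)
    (hC : ∀ n : ℕ, 1 ≤ n →
      ∑ q ∈ Finset.Ico ((2 : ℕ) ^ n) (2 ^ (64 * n)), epsq α c q ≤ c * C)
    (hcC : 160 * (c * C) ≤ δ / 96) (hcδ2 : 896 * c / δ ≤ δ / 96)
    (n0 g : ℕ) (hn1 : 1 ≤ δ * 2 ^ n0) (hn2 : 1 ≤ c * 2 ^ n0) (hg : n0 + 300 ≤ g) (j : ℕ)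
    (hgood : GoodN α c g j) :
    ∃ Ch : Finset ℕ, Ch ⊆ Finset.Ico (j * 2 ^ (63 * (64 * 2 ^ g))) ((j + 1) * 2 ^ (63 * (64 * 2 ^ g))) ∧
      2 ^ (63 * (64 * 2 ^ g) - 3 * g) ≤ Ch.card ∧
      ∀ J ∈ Ch, GoodN α c (g + 6) J ∧
        ∀ x ∈ Set.Icc ((J : ℝ) / (2 : ℝ) ^ (64 * 2 ^ (g + 6)))
          (((J : ℝ) + 1) / (2 : ℝ) ^ (64 * 2 ^ (g + 6))), Pr α c g x := by
  have hgl := lg_lt g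
  have hlog2 : Real.log 2 ≤ 1 := by linarith [Real.log_two_lt_d9]
  have hlog2' : (69 : ℝ) / 100 ≤ Real.log 2 := by linarith [Real.log_two_gt_d9]
  have hlog2p : 0 < Real.log 2 := by linarith
  have hδpow : ∀ n, n0 ≤ n → 1 ≤ δ * 2 ^ n := by
    intro n hn
    refine hn1.trans ?_
    gcongr
    norm_num
  have hcpow : ∀ n, n0 ≤ n → 1 ≤ c * 2 ^ n := by
    intro n hn
    refine hn2.trans ?_
    gcongr
    norm_num
  obtain ⟨r, p0, hr, hrn, hrδ, hrp, hcop, hra⟩ := dirichlet_r hα ((2 ^ (64 * 2 ^ g)) ^ 32)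
    (Nat.one_le_pow _ _ (by positivity))
  have hr0 : (0 : ℝ) < r := by exact_mod_cast hr
  have hTr : (2 : ℝ) ^ (1984 * 2 ^ g) ≤ r := by
    refine le_trans ?_ hrδ
    push_cast
    have e : ((2 : ℝ) ^ (64 * 2 ^ g)) ^ 32 = 2 ^ (64 * 2 ^ g) * 2 ^ (1984 * 2 ^ g) := by
      rw [← pow_mul, ← pow_add]; congr 1; ring
    rw [e, ← mul_assoc]
    exact le_mul_of_one_le_left (by positivity) (hδpow _ (by omega))
  have hWe : (((2 : ℕ) ^ (22 + 2 * g) : ℕ) : ℝ) = (2048 * 2 ^ g) ^ 2 := by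
    push_cast; rw [mul_pow, ← pow_mul, pow_add, mul_comm g 2]; norm_num
  have hlogr1 : (1024 : ℝ) * 2 ^ g ≤ Real.log r := by
    have h := Real.log_le_log (by positivity) hTr
    rw [Real.log_pow] at h
    push_cast at h
    have hp : (0 : ℝ) < 2 ^ g := by positivity
    nlinarith
  have hlogr2 : Real.log r ≤ 2048 * 2 ^ g := by
    have hrn' : (r : ℝ) ≤ (2 : ℝ) ^ (2048 * 2 ^ g) := by
      have e : ((2 : ℕ) ^ (64 * 2 ^ g)) ^ 32 = 2 ^ (2048 * 2 ^ g) := by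
        rw [← pow_mul]; congr 1; ring
      rw [e] at hrn
      exact_mod_cast hrn
    have h := Real.log_le_log hr0 hrn'
    rw [Real.log_pow] at h
    push_cast at h
    have hp : (0 : ℝ) < 2 ^ g := by positivity
    nlinarith
  have hW0 : (0 : ℝ) < (2048 * 2 ^ g) ^ 2 := by positivity
  have hgr : 2 ^ g ≤ r := by
    have h : (2 : ℝ) ^ g ≤ r := by
      refine le_trans ?_ hTr
      gcongr
      · norm_num
      · omega
    exact_mod_cast h
  have hst := step0 hδ hδ1 hα c C hc hcδ hC hcC hcδ2 (16 * 2 ^ g) r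
    (2 ^ (16 * 2 ^ g)) (2 ^ (22 + 2 * g)) (2 ^ (64 * 2 ^ g)) (2 ^ (2 ^ g))
    (2 ^ (2048 * 2 ^ g - 23 - 2 * g)) j (by omega) rfl p0 Nat.one_le_two_pow
    ?_ ?_ ?_ ?_ hcop ?_ hr ?_ ?_ Nat.one_le_two_pow ?_ Nat.one_le_two_pow ?_ ?_ ?_ ?_
  · obtain ⟨Ch, hCh1, hCh2, hCh3⟩ := hst
    refine ⟨Ch, ?_, ?_, ?_⟩
    · have e : ((2 : ℕ) ^ (64 * 2 ^ g)) ^ 63 = 2 ^ (63 * (64 * 2 ^ g)) := by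
        rw [← pow_mul, mul_comm]
      rw [e] at hCh1
      exact hCh1
    · have h : (2 : ℝ) ^ (63 * (64 * 2 ^ g) - 3 * g) ≤ Ch.card := by
        refine le_trans ?_ hCh2
        rw [le_div_iff₀ (by positivity)]
        push_cast
        have e1 : (2 : ℝ) ^ (63 * (64 * 2 ^ g) - 3 * g) * (16 * 2 ^ (22 + 2 * g)) =
            2 ^ (63 * (64 * 2 ^ g) - 3 * g + (26 + 2 * g)) := by
          rw [pow_add _ _ (26 + 2 * g)]
          congr 1
          rw [show 26 + 2 * g = 4 + (22 + 2 * g) by ring, pow_add _ 4]; norm_num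
        have e2 : ((2 : ℝ) ^ (64 * 2 ^ g)) ^ 63 =
            2 ^ n0 * 2 ^ (63 * (64 * 2 ^ g) - n0) := by
          rw [← pow_mul, ← pow_add]; congr 1; omega
        rw [e1, e2, ← mul_assoc δ]
        refine le_trans ?_ (le_mul_of_one_le_left (by positivity) hn1)
        gcongr
        · norm_num
        · omega
      exact_mod_cast h
    · intro J hJ
      obtain ⟨h1, h2⟩ := hCh3 J hJ
      have e64 : (64 * 2 ^ (g + 6) : ℕ) = 64 * 2 ^ g * 64 := by rw [pow_add]; ring
      have e6 : (2 ^ (g + 6) : ℕ) = 64 * 2 ^ g := by rw [pow_add]; ring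
      refine ⟨?_, ?_⟩
      · unfold GoodN
        rw [e64, e6, pow_mul (2 : ℝ), pow_mul (2 : ℕ) (64 * 2 ^ g) 64]
        push_cast at h1
        exact h1
      · intro x hx
        rw [e64, pow_mul (2 : ℝ)] at hx
        push_cast at h2
        obtain ⟨h3, h4⟩ := h2 x hx
        refine ⟨by intro q hq; exact h3 q (by exact_mod_cast hq), r, hgr, ?_⟩
        have h4' : nint (r * x) ≤ 1 / (2048 * 2 ^ g) ^ 2 := by
          rw [← hWe]; push_cast; exact h4
        have h5 : (Real.log r) ^ 2 ≤ (2048 * 2 ^ g) ^ 2 := by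
          apply pow_le_pow_left₀ _ hlogr2
          exact Real.log_nonneg (by exact_mod_cast hr)
        have n1 := nint_nonneg (r * x)
        have n2 := nint_nonneg (r * α)
        calc (r : ℝ) * (Real.log r) ^ 2 * nint (r * α) * nint (r * x)
            = (r * nint (r * α)) * ((Real.log r) ^ 2 * nint (r * x)) := by ring
          _ ≤ 1 * ((2048 * 2 ^ g) ^ 2 * (1 / (2048 * 2 ^ g) ^ 2)) := by gcongr
          _ = 1 := by field_simp
  · push_cast
    have e1 : (2 : ℝ) ^ 180 * ((2 : ℝ) ^ (22 + 2 * g)) ^ 2 = 2 ^ (224 + 4 * g) := by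
      rw [← pow_mul, ← pow_add]; congr 1; ring
    have e2 : δ ^ 2 * (2 : ℝ) ^ (16 * 2 ^ g) = (δ * 2 ^ n0) ^ 2 * 2 ^ (16 * 2 ^ g - 2 * n0) := by
      rw [mul_pow, mul_assoc, ← pow_mul, ← pow_add]; congr 2; omega
    rw [e1, e2]
    refine le_trans ?_ (le_mul_of_one_le_left (by positivity) (one_le_pow₀ hn1))
    gcongr
    · norm_num
    · omega
  · rw [← pow_mul] at hrn ⊢
    refine hrn.trans (le_of_eq ?_)
    congr 1; ring
  · push_cast at hrδ ⊢
    refine le_trans (le_of_eq ?_) hrδ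
    rw [← pow_mul, ← pow_mul]; congr 2; ring
  · push_cast at hrp ⊢
    refine hrp.trans (le_of_eq ?_)
    rw [← pow_mul, ← pow_mul]; congr 2; ring
  · rw [hWe]
    have := pow_le_pow_left₀ (by positivity) hlogr1 2
    calc ((2048 : ℝ) * 2 ^ g) ^ 2 = 4 * (1024 * 2 ^ g) ^ 2 := by ring
      _ ≤ _ := by linarith
  · rw [← pow_mul]; congr 1; ring
  · rw [← pow_mul, mul_assoc 2 (2 ^ (22 + 2 * g)), ← pow_add, ← pow_succ']
    congr 1; omega
  · calc 2 = 2 ^ 1 := by norm_num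
      _ ≤ 2 ^ (2 ^ g) := Nat.pow_le_pow_right (by norm_num) Nat.one_le_two_pow
  · intro q hq1 hq2
    have hq0 : (0 : ℝ) < q := by exact_mod_cast hq1
    have h1 : Real.log q ≤ 2 ^ (g + 6) := by
      have hq' : (q : ℝ) ≤ (2 : ℝ) ^ (64 * 2 ^ g) := by exact_mod_cast hq2.le
      have h := Real.log_le_log hq0 hq'
      rw [Real.log_pow] at h
      push_cast at h
      have hp : (0 : ℝ) < 2 ^ g := by positivity
      rw [pow_add]
      nlinarith
    have h2 : (Real.log q) ^ 2 ≤ ((2 : ℝ) ^ (g + 6)) ^ 2 :=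
      pow_le_pow_left₀ (Real.log_nonneg (by exact_mod_cast hq1)) h1 2
    refine h2.trans ?_
    push_cast
    rw [← pow_mul]
    exact pow_le_pow_right₀ (by norm_num) (by omega)
  · push_cast; exact hcpow _ (by omega)
  · push_cast
    have e : (2 : ℝ) ^ (64 * 2 ^ g) = 2 ^ n0 * 2 ^ (64 * 2 ^ g - n0) := by
      rw [← pow_add]; congr 1; omega
    rw [e, ← mul_assoc]
    refine le_trans ?_ (le_mul_of_one_le_left (by positivity) hn1)
    calc (4 : ℝ) = 2 ^ 2 := by norm_num
      _ ≤ _ := by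
        gcongr
        · norm_num
        · omega
  · unfold GoodN at hgood
    push_cast
    exact hgood

theorem child_enum (S : Finset ℕ) (n : ℕ) (h : n ≤ S.card) :
    ∃ e : ℕ → ℕ, (∀ i i', i < i' → i' < n → e i < e i') ∧ ∀ i < n, e i ∈ S := by
  classical
  refine ⟨fun i => if h' : i < n then S.orderEmbOfCardLe h ⟨i, h'⟩ else 0, ?_, ?_⟩
  · intro i i' h1 h2
    have h3 : i < n := h1.trans h2
    simp only [h2, h3, dif_pos]
    exact (S.orderEmbOfCardLe h).strictMono (by simpa using h1)
  · intro i hi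
    simp only [hi, dif_pos]
    exact S.orderEmbOfCardLe_mem h _

theorem tree_phi (L m D : ℕ → ℕ) (hL : ∀ k, L (k+1) = L k + D k)
    (G : ℕ → ℕ → Prop) (P : ℕ → ℝ → Prop)
    (step : ∀ k j, G k j → ∃ S : Finset ℕ, S ⊆ Finset.Ico (j*2^(D k)) ((j+1)*2^(D k)) ∧
      2^(m k) ≤ S.card ∧ ∀ J ∈ S, G (k+1) J ∧
        ∀ x ∈ Set.Icc ((J:ℝ)/(2:ℝ)^(L (k+1))) (((J:ℝ)+1)/(2:ℝ)^(L (k+1))), P k x)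
    (j0 : ℕ) (h0 : G 0 j0) :
    ∃ Φ : ℝ → ℝ, (∀ x ∈ Set.Ico (0:ℝ) 1, ∀ k, P k (Φ x)) ∧
      ∀ x ∈ Set.Ico (0:ℝ) 1, ∀ y ∈ Set.Ico (0:ℝ) 1, ∀ k,
        3 ≤ (y - x) * (2:ℝ)^(∑ i ∈ Finset.range k, m i) →
        (y - x) * (2:ℝ)^(∑ i ∈ Finset.range k, m i) / (3 * (2:ℝ)^(L k)) ≤ Φ y - Φ x := by
  classical
  have step' : ∀ k j, ∃ e : ℕ → ℕ, G k j → ((∀ i i', i < i' → i' < 2^(m k) → e i < e i') ∧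
      ∀ i < 2^(m k), (j*2^(D k) ≤ e i ∧ e i + 1 ≤ (j+1)*2^(D k)) ∧ G (k+1) (e i) ∧
        ∀ x ∈ Set.Icc ((e i:ℝ)/(2:ℝ)^(L (k+1))) (((e i:ℝ)+1)/(2:ℝ)^(L (k+1))), P k x) := by
    intro k j
    by_cases hG : G k j
    · obtain ⟨S, hS, hc, hP⟩ := step k j hG
      obtain ⟨e, he, heS⟩ := child_enum S _ hc
      refine ⟨e, fun _ => ⟨he, fun i hi => ⟨?_, hP _ (heS i hi)⟩⟩⟩
      have := Finset.mem_Ico.1 (hS (heS i hi))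
      exact ⟨this.1, this.2⟩
    · exact ⟨id, fun h => absurd h hG⟩
  choose c hc using step'
  set M : ℕ → ℕ := fun k => ∑ i ∈ Finset.range k, m i with hM
  have hM1 : ∀ k, M (k+1) = M k + m k := fun k => Finset.sum_range_succ _ _
  let a : ℕ → ℕ → ℕ := fun k => Nat.rec (fun _ => j0)
    (fun k f i => c k (f (i / 2^(m k))) (i % 2^(m k))) k
  have ha0 : ∀ i, a 0 i = j0 := fun i => rfl
  have ha1 : ∀ k i, a (k+1) i = c k (a k (i / 2^(m k))) (i % 2^(m k)) := fun k i => rfl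
  clear_value a
  have hmod : ∀ k i, i % 2^(m k) < 2^(m k) := fun k i => Nat.mod_lt _ (by positivity)
  have hG : ∀ k i, G k (a k i) := by
    intro k
    induction k with
    | zero => intro i; rw [ha0]; exact h0
    | succ k ih =>
      intro i
      rw [ha1]
      exact ((hc k _ (ih _)).2 _ (hmod k i)).2.1
  have hnest : ∀ k i, a k (i / 2^(m k)) * 2^(D k) ≤ a (k+1) i ∧
      a (k+1) i + 1 ≤ (a k (i / 2^(m k)) + 1) * 2^(D k) := by
    intro k i
    rw [ha1]
    exact ((hc k _ (hG k _)).2 _ (hmod k i)).1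
  have hP : ∀ k i, ∀ x ∈ Set.Icc ((a (k+1) i:ℝ)/(2:ℝ)^(L (k+1))) (((a (k+1) i:ℝ)+1)/(2:ℝ)^(L (k+1))), P k x := by
    intro k i
    rw [ha1]
    exact ((hc k _ (hG k _)).2 _ (hmod k i)).2.2
  have hmono : ∀ k i i', i < i' → i' < 2^(M k) → a k i < a k i' := by
    intro k
    induction k with
    | zero => intro i i' h1 h2; simp [hM] at h2; omega
    | succ k ih =>
      intro i i' h1 h2
      rw [hM1, pow_add] at h2
      have hq' : i' / 2^(m k) < 2^(M k) := by
        rw [Nat.div_lt_iff_lt_mul (by positivity)]; exact h2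
      have hle : i / 2^(m k) ≤ i' / 2^(m k) := Nat.div_le_div_right h1.le
      rcases hle.lt_or_eq with hlt | heq
      · have h3 := ih _ _ hlt hq'
        have h4 := (hnest k i).2
        have h5 := (hnest k i').1
        have h6 : (a k (i / 2^(m k)) + 1) * 2^(D k) ≤ a k (i' / 2^(m k)) * 2^(D k) :=
          Nat.mul_le_mul_right _ h3
        omega
      · rw [ha1, ha1, ← heq]
        refine (hc k _ (hG k _)).1 _ _ ?_ (hmod k i')
        have e1 := Nat.div_add_mod i (2^(m k))
        have e2 := Nat.div_add_mod i' (2^(m k))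
        rw [← heq] at e2
        omega
  have hgap : ∀ k i d, i + d < 2^(M k) → a k i + d ≤ a k (i+d) := by
    intro k i d
    induction d with
    | zero => intro _; simp
    | succ d ih =>
      intro h
      have h1 := ih (by omega)
      have h2 := hmono k (i+d) (i+(d+1)) (by omega) h
      omega
  let I : ℝ → ℕ → ℕ := fun x k => ⌊x * (2:ℝ)^(M k)⌋₊
  have hI : ∀ x k, I x (k+1) / 2^(m k) = I x k := by
    intro x k
    have := Nat.floor_div_natCast (x * (2:ℝ)^(M (k+1))) (2^(m k))
    simp only [I]
    rw [← this, hM1, pow_add]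
    congr 1
    push_cast
    field_simp
  have hPhi : ∀ x : ℝ, ∃ z : ℝ, ∀ k, (a k (I x k) : ℝ) / 2^(L k) ≤ z ∧ z ≤ ((a k (I x k) : ℝ)+1) / 2^(L k) := by
    intro x
    have hn : ∀ k, ((a k (I x k) : ℝ) / 2^(L k) ≤ (a (k+1) (I x (k+1)) : ℝ) / 2^(L (k+1))) ∧
        (((a (k+1) (I x (k+1)) : ℝ) + 1) / 2^(L (k+1)) ≤ ((a k (I x k) : ℝ)+1) / 2^(L k)) := by
      intro k
      have h := hnest k (I x (k+1))
      rw [hI] at h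
      have h1 : (a k (I x k) : ℝ) * 2^(D k) ≤ (a (k+1) (I x (k+1)) : ℝ) := by exact_mod_cast h.1
      have h2 : (a (k+1) (I x (k+1)) : ℝ) + 1 ≤ ((a k (I x k) : ℝ)+1) * 2^(D k) := by exact_mod_cast h.2
      rw [hL, pow_add]
      constructor
      · rw [div_le_div_iff₀ (by positivity) (by positivity)]
        have := mul_le_mul_of_nonneg_right h1 (by positivity : (0:ℝ) ≤ 2^(L k))
        linarith
      · rw [div_le_div_iff₀ (by positivity) (by positivity)]
        have := mul_le_mul_of_nonneg_right h2 (by positivity : (0:ℝ) ≤ 2^(L k))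
        linarith
    have hanti : Antitone (fun k => Set.Icc ((a k (I x k) : ℝ) / 2^(L k)) (((a k (I x k) : ℝ)+1) / 2^(L k))) :=
      antitone_nat_of_succ_le fun k => Set.Icc_subset_Icc (hn k).1 (hn k).2
    have := ciSup_mem_iInter_Icc_of_antitone_Icc hanti (fun k => by gcongr; linarith)
    rw [Set.mem_iInter] at this
    exact ⟨_, this⟩
  choose Φ hΦ using hPhi
  refine ⟨Φ, fun x _ k => hP k _ _ (hΦ x (k+1)), ?_⟩
  intro x hx y hy k h3
  change 3 ≤ (y - x) * (2:ℝ)^(M k) at h3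
  change (y - x) * (2:ℝ)^(M k) / (3 * (2:ℝ)^(L k)) ≤ Φ y - Φ x
  have hpos : (0:ℝ) < 2^(M k) := by positivity
  have f1 : (I x k : ℝ) ≤ x * 2^(M k) := Nat.floor_le (mul_nonneg hx.1 hpos.le)
  have f2 : y * 2^(M k) < (I y k : ℝ) + 1 := Nat.lt_floor_add_one _
  have f3 : (I y k : ℝ) ≤ y * 2^(M k) := Nat.floor_le (mul_nonneg hy.1 hpos.le)
  have f4 : I y k < 2^(M k) := by
    have : (I y k : ℝ) < 2^(M k) := by nlinarith [hy.2]
    exact_mod_cast this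
  have f5 : I x k ≤ I y k := by
    have : (I x k : ℝ) ≤ I y k := by nlinarith
    exact_mod_cast this
  have f6 := hgap k (I x k) (I y k - I x k) (by omega)
  rw [Nat.add_sub_cancel' f5] at f6
  have f7 : (a k (I x k) : ℝ) + ((I y k : ℝ) - I x k) ≤ a k (I y k) := by
    have : ((a k (I x k) + (I y k - I x k) : ℕ) : ℝ) ≤ a k (I y k) := by exact_mod_cast f6
    rwa [Nat.cast_add, Nat.cast_sub f5] at this
  have p1 := (hΦ y k).1
  have p2 := (hΦ x k).2
  have p3 : (y - x) * (2:ℝ)^(M k) / (3 * (2:ℝ)^(L k)) ≤ (a k (I y k) : ℝ) / 2^(L k) - ((a k (I x k) : ℝ)+1) / 2^(L k) := by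
    rw [← sub_div, ← div_div]
    apply div_le_div_of_nonneg_right _ (by positivity)
    nlinarith
  linarith

theorem holder_real (ρ d t C0 A E : ℝ) (hρ0 : 0 < ρ) (hρ1 : ρ < 1) (hd : 0 < d)
    (h1 : d * (2:ℝ)^A < 3) (h2 : d * (2:ℝ)^(-E) / 3 ≤ t) (hg : E * ρ ≤ A * (1-ρ) + C0) :
    d ≤ 3 * (2:ℝ)^C0 * t^ρ := by
  have ha : d ≤ 3 * (2:ℝ)^(-A) := by
    rw [Real.rpow_neg (by norm_num), ← div_eq_mul_inv, le_div_iff₀ (by positivity)]; exact h1.le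
  have hb : d^(1-ρ) ≤ 3^(1-ρ) * (2:ℝ)^(-A*(1-ρ)) := by
    have := Real.rpow_le_rpow hd.le ha (by linarith : 0 ≤ 1-ρ)
    rwa [Real.mul_rpow (by norm_num) (by positivity), ← Real.rpow_mul (by norm_num)] at this
  have hc : d^ρ * (2:ℝ)^(-E*ρ) / 3^ρ ≤ t^ρ := by
    have := Real.rpow_le_rpow (by positivity) h2 hρ0.le
    rwa [Real.div_rpow (by positivity) (by norm_num), Real.mul_rpow (by positivity) (by positivity),
      ← Real.rpow_mul (by norm_num)] at this
  have hde : d = d^(1-ρ) * d^ρ := by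
    rw [← Real.rpow_add hd]; simp
  have h3 : (3:ℝ) = 3^(1-ρ) * 3^ρ := by
    rw [← Real.rpow_add (by norm_num)]; simp
  have hexp : (2:ℝ)^(-A*(1-ρ)) ≤ (2:ℝ)^C0 * (2:ℝ)^(-E*ρ) := by
    rw [← Real.rpow_add (by norm_num)]
    exact Real.rpow_le_rpow_of_exponent_le (by norm_num) (by linarith)
  calc d = d^(1-ρ) * d^ρ := hde
    _ ≤ (3^(1-ρ) * (2:ℝ)^(-A*(1-ρ))) * d^ρ := by gcongr
    _ ≤ (3^(1-ρ) * ((2:ℝ)^C0 * (2:ℝ)^(-E*ρ))) * d^ρ := by gcongr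
    _ = (3^(1-ρ) * 3^ρ) * (2:ℝ)^C0 * (d^ρ * (2:ℝ)^(-E*ρ) / 3^ρ) := by
        have : (3:ℝ)^ρ ≠ 0 := by positivity
        field_simp
    _ = 3 * (2:ℝ)^C0 * (d^ρ * (2:ℝ)^(-E*ρ) / 3^ρ) := by rw [← h3]
    _ ≤ 3 * (2:ℝ)^C0 * t^ρ := by gcongr

theorem tree_dim (L m D : ℕ → ℕ) (hL : ∀ k, L (k+1) = L k + D k)
    (G : ℕ → ℕ → Prop) (P : ℕ → ℝ → Prop)
    (step : ∀ k j, G k j → ∃ S : Finset ℕ, S ⊆ Finset.Ico (j*2^(D k)) ((j+1)*2^(D k)) ∧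
      2^(m k) ≤ S.card ∧ ∀ J ∈ S, G (k+1) J ∧
        ∀ x ∈ Set.Icc ((J:ℝ)/(2:ℝ)^(L (k+1))) (((J:ℝ)+1)/(2:ℝ)^(L (k+1))), P k x)
    (j0 : ℕ) (h0 : G 0 j0) (hm : ∀ k, 1 ≤ m k) (ρ : NNReal) (hρ0 : 0 < ρ) (hρ1 : ρ < 1)
    (C0 : ℝ) (hgr : ∀ k, ((L (k+1) : ℝ) - (∑ i ∈ Finset.range (k+1), m i : ℕ)) * ρ ≤
      (∑ i ∈ Finset.range k, m i : ℕ) * (1 - (ρ:ℝ)) + C0) :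
    (ρ : ENNReal) ≤ dimH {x : ℝ | ∀ k, P k x} := by
  obtain ⟨Φ, hP, hΦ⟩ := tree_phi L m D hL G P step j0 h0
  set M : ℕ → ℕ := fun k => ∑ i ∈ Finset.range k, m i with hM
  have hMk : ∀ k, k ≤ M k := by
    intro k
    induction k with
    | zero => simp
    | succ k ih =>
      have : M (k+1) = M k + m k := Finset.sum_range_succ _ _
      have := hm k
      omega
  have key : ∀ x ∈ Set.Ico (0:ℝ) 1, ∀ y ∈ Set.Ico (0:ℝ) 1, x < y →
      0 < Φ y - Φ x ∧ y - x ≤ 3 * (2:ℝ)^C0 * (Φ y - Φ x)^(ρ:ℝ) := by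
    intro x hx y hy hxy
    classical
    have hd : 0 < y - x := by linarith
    have hex : ∃ k, 3 ≤ (y - x) * (2:ℝ)^(M k) := by
      obtain ⟨n, hn⟩ := pow_unbounded_of_one_lt (3/(y-x)) (by norm_num : (1:ℝ) < 2)
      refine ⟨n, ?_⟩
      have h1 : (2:ℝ)^n ≤ 2^(M n) := pow_le_pow_right₀ (by norm_num) (hMk n)
      rw [div_lt_iff₀ hd] at hn
      nlinarith
    have hk := Nat.find_spec hex
    have hmin := fun j => @Nat.find_min _ _ hex j
    set K := Nat.find hex
    have hM0 : M 0 = 0 := by simp [hM]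
    rcases K with _ | k
    · rw [hM0] at hk
      simp at hk
      have := hx.1; have := hy.2; linarith
    · have h1 := hmin k (Nat.lt_succ_self k)
      push Not at h1
      have h2 := hΦ x hx y hy (k+1) hk
      change (y - x) * (2:ℝ)^(M (k+1)) / _ ≤ _ at h2
      refine ⟨lt_of_lt_of_le (by positivity) h2, ?_⟩
      refine holder_real ρ (y-x) _ C0 (M k) ((L (k+1) : ℝ) - M (k+1)) (by exact_mod_cast hρ0)
        (by exact_mod_cast hρ1) hd ?_ ?_ (hgr k)
      · rw [Real.rpow_natCast]; exact h1
      · refine le_trans (le_of_eq ?_) h2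
        rw [neg_sub, Real.rpow_sub (by norm_num), Real.rpow_natCast, Real.rpow_natCast]
        field_simp
  have hinj : Set.InjOn Φ (Set.Ico (0:ℝ) 1) := by
    intro x hx y hy h
    rcases lt_trichotomy x y with h' | h' | h'
    · have := (key x hx y hy h').1; linarith
    · exact h'
    · have := (key y hy x hx h').1; linarith
  set f := Function.invFunOn Φ (Set.Ico (0:ℝ) 1)
  have hf : ∀ x ∈ Set.Ico (0:ℝ) 1, f (Φ x) = x := fun x hx => hinj.leftInvOn_invFunOn hx
  have hK : 0 ≤ 3 * (2:ℝ)^C0 := by positivity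
  have hhol : HolderOnWith (Real.toNNReal (3 * (2:ℝ)^C0)) ρ f (Φ '' Set.Ico (0:ℝ) 1) := by
    rintro _ ⟨x, hx, rfl⟩ _ ⟨y, hy, rfl⟩
    rw [hf x hx, hf y hy]
    have main : |x - y| ≤ 3 * (2:ℝ)^C0 * |Φ x - Φ y|^(ρ:ℝ) := by
      rcases lt_trichotomy x y with h' | h' | h'
      · have h := key x hx y hy h'
        rw [abs_sub_comm, abs_sub_comm (Φ x), abs_of_pos h.1, abs_of_pos (by linarith)]; exact h.2
      · subst h'; simp; positivity
      · have h := key y hy x hx h'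
        rw [abs_of_pos h.1, abs_of_pos (by linarith)]; exact h.2
    rw [edist_dist, edist_dist, Real.dist_eq, Real.dist_eq,
      ENNReal.ofReal_rpow_of_nonneg (abs_nonneg _) ρ.coe_nonneg]
    have e : ((Real.toNNReal (3 * (2:ℝ)^C0) : NNReal) : ENNReal) = ENNReal.ofReal (3 * (2:ℝ)^C0) := rfl
    rw [e, ← ENNReal.ofReal_mul hK]
    exact ENNReal.ofReal_le_ofReal main
  have h1 := hhol.dimH_image_le hρ0
  have himg : f '' (Φ '' Set.Ico (0:ℝ) 1) = Set.Ico (0:ℝ) 1 := by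
    rw [Set.image_image]
    ext z; constructor
    · rintro ⟨x, hx, rfl⟩; simpa only [hf x hx] using hx
    · intro hz; exact ⟨z, hz, hf z hz⟩
  rw [himg, Real.dimH_of_nonempty_interior (by rw [interior_Ico]; exact ⟨1/2, by norm_num, by norm_num⟩)] at h1
  simp only [Module.finrank_self, Nat.cast_one] at h1
  have h2 : (ρ:ENNReal) ≤ dimH (Φ '' Set.Ico (0:ℝ) 1) := by
    rw [ENNReal.le_div_iff_mul_le (by left; exact_mod_cast hρ0.ne') (by left; simp)] at h1
    simpa using h1
  refine h2.trans (dimH_mono ?_)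
  rintro _ ⟨x, hx, rfl⟩
  exact hP x hx

theorem growth (g0 : ℕ) (ρ : ℝ) (hρ0 : 0 < ρ) (hρ1 : ρ < 1) :
    ∃ C0 : ℝ, ∀ k : ℕ, (((64*2^(g0+6*(k+1)) : ℕ) : ℝ) -
        (∑ i ∈ Finset.range (k+1), (63*(64*2^(g0+6*i)) - 3*(g0+6*i)) : ℕ)) * ρ ≤
      (∑ i ∈ Finset.range k, (63*(64*2^(g0+6*i)) - 3*(g0+6*i)) : ℕ) * (1 - ρ) + C0 := by
  set A : ℝ := 64 * 2^g0 with hA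
  have hA0 : 0 < A := by positivity
  have hL : ∀ k : ℕ, ((64*2^(g0+6*k) : ℕ) : ℝ) = A * 64^k := by
    intro k
    push_cast
    rw [pow_add, pow_mul, hA]; norm_num; ring
  have hS : ∀ k : ℕ, A * 64^k - A - 3 * (k:ℝ)^2 * (g0+6) ≤
      ((∑ i ∈ Finset.range k, (63*(64*2^(g0+6*i)) - 3*(g0+6*i)) : ℕ) : ℝ) := by
    intro k
    induction k with
    | zero => simp
    | succ k ih =>
      rw [Finset.sum_range_succ, Nat.cast_add]
      have h1 : (63*A*64^k - 3*(g0+6*k) : ℝ) ≤ ((63*(64*2^(g0+6*k)) - 3*(g0+6*k) : ℕ) : ℝ) := by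
        have hle : 63*(64*2^(g0+6*k)) ≤ (63*(64*2^(g0+6*k)) - 3*(g0+6*k)) + 3*(g0+6*k) := by omega
        have hle' : ((63*(64*2^(g0+6*k)) : ℕ) : ℝ) ≤ ((63*(64*2^(g0+6*k)) - 3*(g0+6*k) : ℕ) : ℝ) + ((3*(g0+6*k) : ℕ) : ℝ) := by
          exact_mod_cast hle
        rw [Nat.cast_mul, hL] at hle'
        push_cast at hle' ⊢
        linarith
      have hk : (0:ℝ) ≤ k := by positivity
      have hg : (0:ℝ) ≤ g0 := by positivity
      push_cast at h1 ih ⊢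
      have : (g0:ℝ) + 6*k ≤ (2*k+1) * (g0+6) := by nlinarith [mul_nonneg hk hg]
      rw [pow_succ]
      nlinarith
  set ε : ℝ := A * (1-ρ) with hε
  have hε0 : 0 < ε := mul_pos hA0 (by linarith)
  set K : ℝ := 6 * (g0+6) with hK
  have hK0 : 0 < K := by positivity
  refine ⟨2*A + K^2/(4*ε), ?_⟩
  intro k
  rw [hL]
  have s1 := hS (k+1)
  have s0 := hS k
  set X := ((∑ i ∈ Finset.range (k+1), (63*(64*2^(g0+6*i)) - 3*(g0+6*i)) : ℕ) : ℝ)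
  set Y := ((∑ i ∈ Finset.range k, (63*(64*2^(g0+6*i)) - 3*(g0+6*i)) : ℕ) : ℝ)
  have hk2 : ((k:ℝ)+1)^2 ≤ 8^k := by
    have : k + 1 ≤ 2^k := Nat.lt_two_pow_self
    have h' : (k:ℝ)+1 ≤ 2^k := by exact_mod_cast this
    calc ((k:ℝ)+1)^2 ≤ (2^k)^2 := by gcongr
      _ = 4^k := by rw [← pow_mul, mul_comm, pow_mul]; norm_num
      _ ≤ 8^k := by gcongr; norm_num
  have h64 : (64:ℝ)^k = (8^k)^2 := by rw [← pow_mul, mul_comm, pow_mul]; norm_num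
  have hq : K * 8^k ≤ ε * (8^k)^2 + K^2/(4*ε) := by
    have : ε * (8^k)^2 + K^2/(4*ε) - K * 8^k = (2*ε*8^k - K)^2/(4*ε) := by
      field_simp; ring
    have h0 : 0 ≤ (2*ε*8^k - K)^2/(4*ε) := by positivity
    linarith
  have hT : (0:ℝ) ≤ 3 * ((k:ℝ)+1)^2 * (g0+6) := by positivity
  have u1 : (A * 64^(k+1) - X) * ρ ≤ A + 3 * ((k:ℝ)+1)^2 * (g0+6) := by
    push_cast at s1
    have : A * 64^(k+1) - X ≤ A + 3 * ((k:ℝ)+1)^2 * (g0+6) := by linarith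
    nlinarith
  have u2 : (A * 64^k - A - 3 * ((k:ℝ)+1)^2 * (g0+6)) * (1-ρ) ≤ Y * (1-ρ) := by
    apply mul_le_mul_of_nonneg_right _ (by linarith)
    have : 3 * (k:ℝ)^2 * (g0+6) ≤ 3 * ((k:ℝ)+1)^2 * (g0+6) := by gcongr; linarith
    linarith
  have u3 : (A + 3 * ((k:ℝ)+1)^2 * (g0+6)) * (1-ρ) ≤ A + 3 * ((k:ℝ)+1)^2 * (g0+6) := by nlinarith
  have u4 : K * ((k:ℝ)+1)^2 ≤ ε * 64^k + K^2/(4*ε) := by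
    rw [h64]; exact (mul_le_mul_of_nonneg_left hk2 hK0.le).trans hq
  have u5 : A * 64^k * (1-ρ) = ε * 64^k := by rw [hε]; ring
  have u6 : 2 * (3 * ((k:ℝ)+1)^2 * (g0+6)) = K * ((k:ℝ)+1)^2 := by rw [hK]; ring
  linarith

theorem liminf_pos (α c : ℝ) (δ : ℝ) (hδ : 0 < δ)
    (hα : ∀ q : ℕ, 1 ≤ q → δ ≤ (q : ℝ) * nint (q * α)) (hc : 0 < c) (g0 : ℕ) (β : ℝ)
    (h : ∀ k : ℕ, Pr α c (g0 + 6*k) β) :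
    0 < atTop.liminf (fun q : ℕ => (q : ℝ) * (Real.log q) ^ 2 * nint (q * α) * nint (q * β)) := by
  have hev : ∀ᶠ q : ℕ in atTop, c ≤ (q : ℝ) * (Real.log q) ^ 2 * nint (q * α) * nint (q * β) := by
    filter_upwards [eventually_ge_atTop (2^(2^g0)), eventually_ge_atTop 2] with q hq hq2
    have hex : ∃ k, q < 2^(64*2^(g0+6*k)) := by
      refine ⟨q, ?_⟩
      calc q < 2^q := Nat.lt_two_pow_self
        _ ≤ 2^(64*2^(g0+6*q)) := by
          apply Nat.pow_le_pow_right (by norm_num)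
          have : g0 + 6*q < 2^(g0+6*q) := Nat.lt_two_pow_self
          omega
    classical
    have hk := Nat.find_spec hex
    have hmin := fun j => @Nat.find_min _ _ hex j
    set K := Nat.find hex
    have hlow : 2^(2^(g0+6*K)) ≤ q := by
      rcases hK : K with _ | k
      · simpa using hq
      · have := hmin k (by omega)
        push Not at this
        have e : 2^(g0+6*(k+1)) = 64*2^(g0+6*k) := by
          rw [show g0 + 6*(k+1) = (g0+6*k)+6 by ring, pow_add]; ring
        rw [e]; exact this
    have h1 := (h K).1 q (Finset.mem_Ico.2 ⟨hlow, hk⟩)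
    have hnp : 0 < nint (q*α) := nint_pos hδ hα q (by omega)
    have hlog : 0 < Real.log q := Real.log_pos (by exact_mod_cast (by omega : 1 < q))
    have hq0 : (0:ℝ) < q := by exact_mod_cast (by omega : 0 < q)
    unfold epsq at h1
    rw [div_le_iff₀ (by positivity)] at h1
    linarith
  have hfr : ∃ᶠ q : ℕ in atTop, (q : ℝ) * (Real.log q) ^ 2 * nint (q * α) * nint (q * β) ≤ 1 := by
    rw [frequently_atTop]
    intro N
    obtain ⟨r, hr, hr1⟩ := (h N).2
    refine ⟨r, ?_, hr1⟩
    have : g0 + 6*N < 2^(g0+6*N) := Nat.lt_two_pow_self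
    omega
  refine lt_of_lt_of_le hc (le_liminf_of_le ?_ hev)
  exact IsCoboundedUnder.of_frequently_le hfr

theorem stmt_6 (α : ℝ) (hα : ∃ δ > 0, ∀ q : ℕ, 1 ≤ q → δ ≤ (q : ℝ) * nint (q * α)) :
    dimH {β : ℝ | 0 < atTop.liminf (fun q : ℕ => (q : ℝ) * (Real.log q) ^ 2 * nint (q * α) * nint (q * β))} = 1 := by
  obtain ⟨δ, hδ, hα⟩ := hα
  have hδ1 : δ ≤ 1/2 := by
    have h1 := hα 1 le_rfl
    have h2 := nint_le_half ((1:ℕ) * α)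
    push_cast at h1 h2
    linarith
  obtain ⟨C, hC0, hC⟩ := eps_sum hδ hα
  obtain ⟨c, hc, hcδ, hcC, hcδ2⟩ : ∃ c : ℝ, 0 < c ∧ c ≤ δ/4 ∧ 160*(c*C) ≤ δ/96 ∧ 896*c/δ ≤ δ/96 := by
    refine ⟨min (δ/4) (min (δ/96/160/C) (δ/96*δ/896)), by positivity, min_le_left _ _, ?_, ?_⟩
    · have : min (δ/4) (min (δ/96/160/C) (δ/96*δ/896)) ≤ δ/96/160/C :=
        (min_le_right _ _).trans (min_le_left _ _)
      rw [le_div_iff₀ hC0] at this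
      linarith
    · have : min (δ/4) (min (δ/96/160/C) (δ/96*δ/896)) ≤ δ/96*δ/896 :=
        (min_le_right _ _).trans (min_le_right _ _)
      rw [div_le_iff₀ hδ]
      linarith
  obtain ⟨n0, hn1, hn2⟩ : ∃ n0 : ℕ, 1 ≤ δ*2^n0 ∧ 1 ≤ c*2^n0 := by
    obtain ⟨n, hn⟩ := pow_unbounded_of_one_lt (1/c) (by norm_num : (1:ℝ) < 2)
    rw [div_lt_iff₀ hc] at hn
    refine ⟨n, ?_, by linarith⟩
    have : c * 2^n ≤ δ * 2^n := by gcongr; linarith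
    linarith
  have hCc := hC c hc.le
  set g0 := n0 + 300 with hg0
  obtain ⟨j0, hj0⟩ := initial hδ hα c C hc hcδ hCc hcC hδ1 g0
  apply le_antisymm
  · exact (dimH_mono (Set.subset_univ _)).trans (by rw [Real.dimH_univ])
  · have main : ∀ ρ : NNReal, 0 < ρ → ρ < 1 → (ρ : ENNReal) ≤ dimH {x : ℝ | ∀ k : ℕ, Pr α c (g0 + 6*k) x} := by
      intro ρ h0 h1
      obtain ⟨C0, hgr⟩ := growth g0 ρ (by exact_mod_cast h0) (by exact_mod_cast h1)
      refine tree_dim (fun k => 64*2^(g0+6*k)) (fun k => 63*(64*2^(g0+6*k)) - 3*(g0+6*k))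
        (fun k => 63*(64*2^(g0+6*k))) ?_ (fun k j => GoodN α c (g0+6*k) j) _ ?_ j0 hj0 ?_ ρ h0 h1 C0 hgr
      · intro k
        rw [show g0 + 6*(k+1) = (g0+6*k)+6 by ring, pow_add]; ring
      · intro k j hG
        exact step1 hδ hδ1 hα c C hc hcδ hCc hcC hcδ2 n0 (g0+6*k) hn1 hn2 (by omega) j hG
      · intro k
        have : g0 + 6*k < 2^(g0+6*k) := Nat.lt_two_pow_self
        omega
    refine le_trans ?_ (dimH_mono (fun β hβ => liminf_pos α c δ hδ hα hc g0 β hβ) :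
      dimH {x : ℝ | ∀ k : ℕ, Pr α c (g0 + 6*k) x} ≤ _)
    refine le_of_forall_lt_imp_le_of_dense ?_
    intro a ha
    lift a to NNReal using (ha.trans ENNReal.one_lt_top).ne
    rcases eq_or_ne a 0 with h | h
    · simp [h]
    · exact main a (pos_iff_ne_zero.2 h) (by exact_mod_cast ha)
end
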